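/- Let r, k, j, n be integers with n ≥ 5r+19, r+1 ≥ k ≥ 5 and j ≥ 5, and let Z be a simple graph on k vertices and j edges which contains Z_4 as a subgraph but does not contain a cycle on 4 vertices. Then σ(K_{r+1} − Z, n) = (r−1)(2n−r) − 3(n−r) − 1 if n−r is odd, and σ(K_{r+1} − Z, n) = (r−1)(2n−r) − 3(n−r) − 2 if n−r is even. -/

import Mathlib

open SimpleGraph Finset
open scoped Classical

/-- `G` contains a copy of `H` as a subgraph. -/
def ContainsCopy {α β : Type*} (G : SimpleGraph α) (H : SimpleGraph β) : Prop :=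
  ∃ f : β ↪ α, ∀ u v, H.Adj u v → G.Adj (f u) (f v)

/-- `G` is a realization of the degree sequence `d` (vertex `i` has degree `d i`). -/
def IsRealization {n : ℕ} (G : SimpleGraph (Fin n)) (d : Fin n → ℕ) : Prop :=
  ∀ i, G.degree i = d i

/-- `d` is a graphic sequence: it is nonincreasing and is the degree sequence of a
simple graph on `n` vertices. -/
def IsGraphic {n : ℕ} (d : Fin n → ℕ) : Prop :=
  Antitone d ∧ ∃ G : SimpleGraph (Fin n), IsRealization G d

/-- `d` is potentially `H`-graphic: some realization of `d` contains a copy of `H`. -/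
def PotentiallyGraphic {n : ℕ} (d : Fin n → ℕ) {β : Type*} (H : SimpleGraph β) : Prop :=
  ∃ G : SimpleGraph (Fin n), IsRealization G d ∧ ContainsCopy G H

/-- The set of even integers `l` such that every `n`-term graphic sequence with degree sum
at least `l` is potentially `H`-graphic; `σ(H, n)` is the least element of this set. -/
def SigmaSet {β : Type*} (H : SimpleGraph β) (n : ℕ) : Set ℕ :=
  {l | Even l ∧ ∀ d : Fin n → ℕ, IsGraphic d → l ≤ ∑ i, d i → PotentiallyGraphic d H}

/-- `K_m - H`: the complete graph on `m` vertices minus the edge set of a copy of `H`. -/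
def KsubH (m k : ℕ) (h : k ≤ m) (H : SimpleGraph (Fin k)) : SimpleGraph (Fin m) :=
  (⊤ : SimpleGraph (Fin m)) \ H.map (Fin.castLEEmb h)

/-- `Z₄ = K₄ - P₂`: the complete graph on 4 vertices minus two adjacent edges. -/
def Z4 : SimpleGraph (Fin 4) :=
  (⊤ : SimpleGraph (Fin 4)) \ SimpleGraph.fromEdgeSet {s(0, 1), s(1, 2)}

/-- The cycle on 4 vertices. -/
def C4 : SimpleGraph (Fin 4) :=
  SimpleGraph.fromEdgeSet {s(0, 1), s(1, 2), s(2, 3), s(3, 0)}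

/-- 1-indexed access `d_i` to a finite sequence (0 outside the range). -/
def nth {n : ℕ} (d : Fin n → ℕ) (i : ℕ) : ℕ :=
  if h : i - 1 < n then d ⟨i - 1, h⟩ else 0

/-- The neighbourhood of `v` as a finset. -/
noncomputable def nb {V : Type*} [Fintype V] (G : SimpleGraph V) (v : V) : Finset V :=
  univ.filter (G.Adj v)

/-- The degree function with integer values. -/
noncomputable def dz {V : Type*} [Fintype V] (G : SimpleGraph V) (v : V) : ℤ := (nb G v).card

/-- The indicator function of a vertex. -/
noncomputable def dl {V : Type*} (u v : V) : ℤ := if v = u then 1 else 0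

/-- `G` with the edge `uv` added. -/
def addE {V : Type*} (G : SimpleGraph V) (u v : V) : SimpleGraph V := G ⊔ edge u v

/-- `G` with the edge `uv` removed. -/
def delE {V : Type*} (G : SimpleGraph V) (u v : V) : SimpleGraph V := G \ edge u v

section Basics
variable {V : Type*}

@[simp] lemma dl_self (u : V) : dl u u = 1 := by simp [dl]

lemma dl_ne {u v : V} (h : v ≠ u) : dl u v = 0 := by simp [dl, h]

lemma dl_nonneg (u v : V) : 0 ≤ dl u v := by unfold dl; split_ifs <;> simp

lemma adj_addE (G : SimpleGraph V) (u v x y : V) :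
    (addE G u v).Adj x y ↔ G.Adj x y ∨ (u ≠ v ∧ ((x = u ∧ y = v) ∨ (x = v ∧ y = u))) := by
  simp only [addE, sup_adj, edge_adj]
  grind

lemma adj_delE (G : SimpleGraph V) (u v x y : V) :
    (delE G u v).Adj x y ↔ G.Adj x y ∧ ¬ ((x = u ∧ y = v) ∨ (x = v ∧ y = u)) := by
  simp only [delE, sdiff_adj, edge_adj]
  have := @G.ne_of_adj
  grind

/-- Replacing the edges `ab`, `ce` by `ac`, `be`. -/
def switch (G : SimpleGraph V) (a b c e : V) : SimpleGraph V :=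
  addE (addE (delE (delE G a b) c e) a c) b e

lemma adj_switch (G : SimpleGraph V) (a b c e x y : V) (hac : a ≠ c) (hbe : b ≠ e) :
    (switch G a b c e).Adj x y ↔
      (G.Adj x y ∧ ¬ ((x = a ∧ y = b) ∨ (x = b ∧ y = a)) ∧ ¬ ((x = c ∧ y = e) ∨ (x = e ∧ y = c)))
      ∨ ((x = a ∧ y = c) ∨ (x = c ∧ y = a)) ∨ ((x = b ∧ y = e) ∨ (x = e ∧ y = b)) := by
  simp only [switch, adj_addE, adj_delE]
  grind

variable [Fintype V]

@[simp] lemma mem_nb {G : SimpleGraph V} {v w : V} : w ∈ nb G v ↔ G.Adj v w := by simp [nb]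

lemma nb_card_degree (G : SimpleGraph V) (v : V) [Fintype (G.neighborSet v)] :
    (nb G v).card = G.degree v := by
  rw [← card_neighborFinset_eq_degree]
  congr 1
  ext w
  simp

lemma dz_nonneg (G : SimpleGraph V) (v : V) : 0 ≤ dz G v := by simp [dz]

lemma dz_addE {G : SimpleGraph V} {u v : V} (huv : u ≠ v) (h : ¬ G.Adj u v) :
    dz (addE G u v) = dz G + dl u + dl v := by
  funext w
  have hvu : ¬ G.Adj v u := fun h' => h h'.symm
  simp only [dz, dl, Pi.add_apply]
  by_cases h1 : w = u
  · subst h1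
    have : nb (addE G w v) w = insert v (nb G w) := by
      ext x; simp only [mem_nb, adj_addE, mem_insert]; grind
    rw [this, card_insert_of_notMem (by simpa using h)]
    simp [huv]
  · by_cases h2 : w = v
    · subst h2
      have : nb (addE G u w) w = insert u (nb G w) := by
        ext x; simp only [mem_nb, adj_addE, mem_insert]; grind
      rw [this, card_insert_of_notMem (by simpa using hvu)]
      simp [h1]
    · have : nb (addE G u v) w = nb G w := by
        ext x; simp only [mem_nb, adj_addE]; grind
      rw [this]; simp [h1, h2]

lemma dz_delE {G : SimpleGraph V} {u v : V} (h : G.Adj u v) :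
    dz (delE G u v) = dz G - dl u - dl v := by
  have h1 : addE (delE G u v) u v = G := by
    ext x y
    have := h.symm
    have := h.ne
    simp only [adj_addE, adj_delE]; grind
  have h2 := dz_addE (G := delE G u v) h.ne (by simp [adj_delE])
  rw [h1] at h2
  rw [h2]; abel

lemma dz_switch {G : SimpleGraph V} {a b c e : V} (hab : G.Adj a b) (hce : G.Adj c e)
    (hac : ¬ G.Adj a c) (hbe : ¬ G.Adj b e) (hac' : a ≠ c) (hbe' : b ≠ e) :
    dz (switch G a b c e) = dz G := by
  have hab' := hab.ne
  have hce' := hce.ne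
  have hba := hab.symm
  have hec := hce.symm
  have hca : ¬ G.Adj c a := fun h' => hac h'.symm
  have heb : ¬ G.Adj e b := fun h' => hbe h'.symm
  rw [switch, dz_addE hbe', dz_addE hac', dz_delE, dz_delE hab]
  · abel
  · simp only [adj_delE]; grind
  · simp only [adj_delE]; grind
  · simp only [adj_addE, adj_delE]; grind

lemma sum_dz_symm (G : SimpleGraph V) (X Y : Finset V) :
    ∑ x ∈ X, ((nb G x ∩ Y).card : ℤ) = ∑ y ∈ Y, ((nb G y ∩ X).card : ℤ) := by
  have h : ∀ (X : Finset V) (x : V), ((nb G x ∩ X).card : ℤ) = ∑ y ∈ X, if G.Adj x y then 1 else 0 := by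
    intro X x
    rw [inter_comm, ← filter_mem_eq_inter]
    simp
  simp_rw [h]
  rw [sum_comm]
  simp_rw [G.adj_comm]

/-- A maximal element of a nonempty family of graphs with respect to an integer parameter. -/
lemma exists_max_graph (P : SimpleGraph V → Prop) (f : SimpleGraph V → ℕ) (h : ∃ G, P G) :
    ∃ G, P G ∧ ∀ G', P G' → f G' ≤ f G := by
  obtain ⟨G, hG, hmax⟩ := Finset.exists_max_image (univ.filter P) f
    (by obtain ⟨G, hG⟩ := h; exact ⟨G, by simpa using hG⟩)
  exact ⟨G, by simpa using hG, fun G' h' => hmax G' (by simpa using h')⟩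

/-- If `deg o ≤ deg k`, `p` is a neighbour of `o` but not of `k` (and `p ≠ k`), then `k` has a
neighbour which is not a neighbour of `o`. -/
lemma exists_nb_of_dz_le {G : SimpleGraph V} {o k p : V} (hd : dz G o ≤ dz G k)
    (ho : G.Adj o p) (hk : ¬ G.Adj k p) (hpk : p ≠ k) :
    ∃ c, G.Adj k c ∧ ¬ G.Adj o c ∧ c ≠ o := by
  by_contra! hcon
  have hsub : (nb G k).erase o ⊂ (nb G o).erase k := by
    rw [Finset.ssubset_iff_of_subset]
    · refine ⟨p, ?_, ?_⟩
      · simp [ho, hpk]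
      · simp [hk]
    · intro c hc
      simp only [mem_erase, mem_nb] at hc ⊢
      refine ⟨hc.2.ne', ?_⟩
      by_contra h
      exact hc.1 (hcon c hc.2 h)
  have h1 := card_lt_card hsub
  simp only [dz, Nat.cast_le] at hd
  by_cases hok : G.Adj o k
  · rw [card_erase_of_mem (by simpa using hok.symm), card_erase_of_mem (by simpa using hok)] at h1
    omega
  · rw [erase_eq_of_notMem (by simpa using fun h => hok h.symm),
      erase_eq_of_notMem (by simpa using hok)] at h1
    omega

/-- A realization in which `v` is joined to all of `K`, for `K` a set of vertices of largest
degrees. -/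
lemma exists_joined (G : SimpleGraph V) (v : V) (K : Finset V) (hv : v ∉ K)
    (hcard : (K.card : ℤ) ≤ dz G v) (htop : ∀ k ∈ K, ∀ o, o ∉ K → o ≠ v → dz G o ≤ dz G k) :
    ∃ G', dz G' = dz G ∧ ∀ k ∈ K, G'.Adj v k := by
  obtain ⟨G', hd, hmax⟩ := exists_max_graph (fun G' => dz G' = dz G)
    (fun G' => (nb G' v ∩ K).card) ⟨G, rfl⟩
  refine ⟨G', hd, ?_⟩
  by_contra! hcon
  obtain ⟨k, hkK, hk⟩ := hcon
  obtain ⟨o, ho, hoK⟩ : ∃ o, G'.Adj v o ∧ o ∉ K := by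
    by_contra! h
    have : nb G' v ⊂ K := by
      rw [Finset.ssubset_iff_of_subset (fun x hx => h x (by simpa using hx))]
      exact ⟨k, hkK, by simpa using hk⟩
    have := card_lt_card this
    rw [← hd] at hcard
    simp only [dz, Nat.cast_le] at hcard
    omega
  have hkv : k ≠ v := fun h => hv (h ▸ hkK)
  obtain ⟨c, hc1, hc2, hc3⟩ := exists_nb_of_dz_le (G := G') (o := o) (k := k) (p := v)
    (by rw [hd]; exact htop k hkK o hoK ho.ne') ho.symm (fun h => hk h.symm) hkv.symm
  have hsw := dz_switch ho hc1 hk hc2 hkv.symm hc3.symm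
  have := hmax _ (hsw.trans hd)
  have hlt : (nb G' v ∩ K) ⊂ (nb (switch G' v o k c) v ∩ K) := by
    rw [Finset.ssubset_iff_of_subset]
    · refine ⟨k, ?_, ?_⟩
      · simp only [mem_inter, mem_nb, hkK, and_true]
        rw [adj_switch _ _ _ _ _ _ _ hkv.symm hc3.symm]; simp
      · simp [hk]
    · intro x hx
      simp only [mem_inter, mem_nb] at hx ⊢
      refine ⟨?_, hx.2⟩
      rw [adj_switch _ _ _ _ _ _ _ hkv.symm hc3.symm]
      have := hx.1
      have := ho.ne
      grind
  exact absurd (card_lt_card hlt) (by simpa using this)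

end Basics

/-- No edge of `G` has both ends in `A`. -/
def Ind {V : Type*} (A : Finset V) (G : SimpleGraph V) : Prop := ∀ a ∈ A, ∀ b ∈ A, ¬ G.Adj a b

/-- `e` is the degree function of a graph in which `A` is independent. -/
def IndepReal {V : Type*} [Fintype V] (A : Finset V) (e : V → ℤ) : Prop :=
  ∃ G : SimpleGraph V, Ind A G ∧ dz G = e

section Flat
variable {V : Type*} {A : Finset V} {G : SimpleGraph V}

lemma sum_dl {x : V} (hx : x ∈ A) : ∑ a ∈ A, dl x a = 1 := by
  simp [dl, hx]

variable [Fintype V]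

lemma blocked_adj (hA : Ind A G) {x y u w : V} (hx : x ∈ A) (hy : y ∈ A) (hxu : G.Adj x u)
    (hyw : G.Adj y w) (hnot : ¬ IndepReal A (dz G - dl x - dl y)) :
    u = w ∨ G.Adj u w := by
  by_contra! hcon
  have hu : u ∉ A := fun h => hA _ hx _ h hxu
  have hw : w ∉ A := fun h => hA _ hy _ h hyw
  have hux := hxu.symm
  have hwu : ¬ G.Adj w u := fun h => hcon.2 h.symm
  refine hnot ⟨addE (delE (delE G x u) y w) u w, ?_, ?_⟩
  · intro a ha b hb
    have := hA a ha b hb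
    simp only [adj_addE, adj_delE]
    grind
  · rw [dz_addE hcon.1, dz_delE, dz_delE hxu]
    · abel
    · simp only [adj_delE]; grind
    · simp only [adj_delE]; grind

lemma blocked_far (hA : Ind A G) {x y u w b : V} (hx : x ∈ A) (hy : y ∈ A) (hxu : G.Adj x u)
    (hyw : G.Adj y w) (hne : x = y → u ≠ w) (hnot : ¬ IndepReal A (dz G - dl x - dl y))
    (hb : b ∉ A) (hbu : b ≠ u) (hub : ¬ G.Adj u b) :
    ¬ G.Adj y b ∧ ∀ c, G.Adj b c → c ≠ x → c = w ∨ G.Adj w c := by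
  have hyb : ¬ G.Adj y b := by
    intro h
    rcases blocked_adj hA hx hy hxu h hnot with h | h
    · exact hbu h.symm
    · exact hub h
  refine ⟨hyb, ?_⟩
  by_contra! hcon
  obtain ⟨c, hbc, hcx, hcw, hwc⟩ := hcon
  have hu : u ∉ A := fun h => hA _ hx _ h hxu
  have hw : w ∉ A := fun h => hA _ hy _ h hyw
  have hux := hxu.symm
  have hcb := hbc.symm
  have hbu' : ¬ G.Adj b u := fun h => hub h.symm
  have hcw' : ¬ G.Adj c w := fun h => hwc h.symm
  have hbw : b ≠ w := fun h => hyb (h ▸ hyw)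
  have hbc' := hbc.ne
  refine hnot ⟨addE (addE (delE (delE (delE G x u) y w) b c) u b) w c, ?_, ?_⟩
  · intro a ha b hb
    have := hA a ha b hb
    simp only [adj_addE, adj_delE]
    grind
  · rw [dz_addE hcw.symm, dz_addE hbu.symm, dz_delE, dz_delE, dz_delE hxu]
    · abel
    · simp only [adj_delE]; grind
    · simp only [adj_delE]; grind
    · simp only [adj_delE]; grind
    · simp only [adj_addE, adj_delE]; grind

lemma blocked_top (hA : Ind A G) {x y u w q : V} (hx : x ∈ A) (hy : y ∈ A) (hxu : G.Adj x u)
    (hyw : G.Adj y w) (hne : x = y → u ≠ w) (hnot : ¬ IndepReal A (dz G - dl x - dl y))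
    (hq : q ∉ A) (htop : ∀ o ∉ A, dz G o ≤ dz G q) : q = u ∨ G.Adj u q := by
  by_contra! hcon
  obtain ⟨hqu, huq⟩ := hcon
  have hu : u ∉ A := fun h => hA _ hx _ h hxu
  have hw : w ∉ A := fun h => hA _ hy _ h hyw
  obtain ⟨hyq, hfar⟩ := blocked_far hA hx hy hxu hyw hne hnot hq hqu huq
  have huw := blocked_adj hA hx hy hxu hyw hnot
  have hdw := htop w hw
  simp only [dz, Nat.cast_le] at hdw
  have hqy : ¬ G.Adj q y := fun h => hyq h.symm
  have hqu' : ¬ G.Adj q u := fun h => huq h.symm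
  have hwy := hyw.symm
  by_cases huw' : u = w
  · subst huw'
    have hs : insert y (nb G q) ⊆ nb G u := by
      intro c hc
      have := hxu.symm
      simp only [mem_insert, mem_nb] at hc ⊢
      by_cases hcx : c = x <;> grind
    have := card_le_card hs
    rw [card_insert_of_notMem (by simpa using hqy)] at this
    omega
  · have hwu : G.Adj w u := (huw.resolve_left huw').symm
    by_cases hwq : G.Adj w q
    · have hs : insert q (insert y (insert u (nb G q))) ⊆ insert x (insert w (nb G w)) := by
        intro c hc
        simp only [mem_insert, mem_nb] at hc ⊢
        grind
      have := card_le_card hs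
      rw [card_insert_of_notMem, card_insert_of_notMem,
        card_insert_of_notMem (by simpa using hqu')] at this
      · have h1 := card_insert_le x (insert w (nb G w))
        have h2 := card_insert_le w (nb G w)
        omega
      · simp only [mem_insert, mem_nb]; grind
      · simp only [mem_insert, mem_nb, G.irrefl]; grind
    · have hqw : ¬ G.Adj q w := fun h => hwq h.symm
      have hs : (insert y (insert u (nb G q))) ⊆ insert x (nb G w) := by
        intro c hc
        simp only [mem_insert, mem_nb] at hc ⊢
        grind
      have := card_le_card hs
      rw [card_insert_of_notMem, card_insert_of_notMem (by simpa using hqu')] at this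
      · have h1 := card_insert_le x (nb G w)
        omega
      · simp only [mem_insert, mem_nb]; grind

lemma exists_nb_of_pos {x : V} (h : 1 ≤ dz G x) : ∃ u, G.Adj x u := by
  have : 0 < (nb G x).card := by simp only [dz] at h; omega
  obtain ⟨u, hu⟩ := card_pos.1 this
  exact ⟨u, by simpa using hu⟩

lemma exists_nb_pair {x y : V} (hx : 1 ≤ dz G x) (hy : 1 ≤ dz G y) (hxy : x = y → 2 ≤ dz G x) :
    ∃ u w, G.Adj x u ∧ G.Adj y w ∧ (x = y → u ≠ w) := by
  by_cases h : x = y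
  · subst h
    have : 1 < (nb G x).card := by have := hxy rfl; simp only [dz] at this; omega
    obtain ⟨u, hu, w, hw, huw⟩ := one_lt_card.1 this
    exact ⟨u, w, by simpa using hu, by simpa using hw, fun _ => huw⟩
  · obtain ⟨u, hu⟩ := exists_nb_of_pos hx
    obtain ⟨w, hw⟩ := exists_nb_of_pos hy
    exact ⟨u, w, hu, hw, fun h' => absurd h' h⟩

lemma free_pair (hA : Ind A G) {Q : Finset V} {t m : ℤ} (ht : 0 ≤ t)
    (hO : ∀ o ∉ A, dz G o ≤ m) (hQ : ∀ q ∈ Q, q ∉ A ∧ dz G q = m) (hQm : m ≤ Q.card + t + 2)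
    (hAf : ∀ a ∈ A, dz G a ≤ Q.card + t + 2)
    (hbig : (Q.card : ℤ) ≤ m → m * (t + 4) + m * m < ∑ o ∈ Aᶜ, dz G o) {x y : V}
    (hx : x ∈ A) (hy : y ∈ A) (hx1 : 1 ≤ dz G x) (hy1 : 1 ≤ dz G y) (hxy : x = y → 2 ≤ dz G x) :
    IndepReal A (dz G - dl x - dl y) := by
  by_contra hnot
  obtain ⟨u, w, hxu, hyw, hne⟩ := exists_nb_pair hx1 hy1 hxy
  have hu : u ∉ A := fun h => hA _ hx _ h hxu
  have hw : w ∉ A := fun h => hA _ hy _ h hyw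
  have huw := blocked_adj hA hx hy hxu hyw hnot
  have htop : ∀ q ∈ Q, q = u ∨ G.Adj u q := fun q hq =>
    blocked_top hA hx hy hxu hyw hne hnot (hQ q hq).1 (fun o ho => (hQ q hq).2 ▸ hO o ho)
  have hdu := hO u hu
  have hdw := hO w hw
  have hm0 : 0 ≤ m := (dz_nonneg _ _).trans hdu
  simp only [dz] at hdu hdw
  have hNu : (((insert u (nb G u)).erase x).card : ℤ) ≤ m := by
    rw [card_erase_of_mem (by simp [hxu.symm])]
    have := card_insert_le u (nb G u)
    have : 0 < (insert u (nb G u)).card := card_pos.2 (insert_nonempty _ _)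
    omega
  have hQcard : (Q.card : ℤ) ≤ m := by
    refine le_trans ?_ hNu
    rw [Nat.cast_le]
    refine card_le_card fun q hq => ?_
    have := htop q hq
    have := (hQ q hq).1
    simp only [mem_erase, mem_insert, mem_nb]
    grind
  have hsum := hbig hQcard
  set L : Finset V := Aᶜ \ insert u (nb G u) with hL
  set T : Finset V := ((insert x (insert w (nb G w))).erase y).erase u with hT
  have hTcard : (T.card : ℤ) ≤ m := by
    rw [hT, card_erase_of_mem, card_erase_of_mem]
    · have h1 := card_insert_le x (insert w (nb G w))
      have h2 := card_insert_le w (nb G w)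
      omega
    · simp [hyw.symm]
    · have := hxu.symm
      have : u ≠ y := fun h => hu (h ▸ hy)
      simp only [mem_erase, mem_insert, mem_nb]
      rcases huw with h | h
      · grind
      · have := h.symm
        grind
  have memL : ∀ b ∈ L, b ∉ A ∧ b ≠ u ∧ ¬ G.Adj u b := by
    intro b hb
    simpa [hL] using hb
  have hfar : ∀ b ∈ L, ¬ G.Adj y b ∧ nb G b ⊆ T := by
    intro b hb
    obtain ⟨h1, h2, h3⟩ := memL b hb
    obtain ⟨h4, h5⟩ := blocked_far hA hx hy hxu hyw hne hnot h1 h2 h3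
    refine ⟨h4, fun c hc => ?_⟩
    rw [mem_nb] at hc
    have := h5 c hc
    have := hc.symm
    simp only [hT, mem_erase, mem_insert, mem_nb]
    grind
  have hsq : ∀ b ∈ L, ∀ s, G.Adj b s → ∀ q ∈ Q, q ≠ s → q ≠ u → G.Adj s q := by
    intro b hb s hbs q hq hqs hqu
    by_contra hsq
    obtain ⟨h1, h2, h3⟩ := memL b hb
    obtain ⟨h4, -⟩ := hfar b hb
    have huq := (htop q hq).resolve_left hqu
    have hqA := (hQ q hq).1
    have hbu : ¬ G.Adj b u := fun h => h3 h.symm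
    have hdz := dz_switch hbs.symm huq.symm hsq hbu hqs.symm h2
    have hadj := fun x y => adj_switch G s b q u x y hqs.symm h2
    have := blocked_top (G := switch G s b q u) (x := x) (y := y) (u := u) (w := w) (q := q)
      (A := A) ?_ hx hy ?_ ?_ hne (by rw [hdz]; exact hnot) hqA
      (by rw [hdz, (hQ q hq).2]; exact hO)
    · rw [hadj] at this
      have := huq.ne
      have := hbs.symm
      grind
    · intro a ha b hb
      have := hA a ha b hb
      rw [hadj]; grind
    · rw [hadj]; grind
    · rw [hadj]; grind
  have hdegL : ∀ s ∈ T, ((nb G s ∩ L).card : ℤ) ≤ t + 4 := by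
    intro s hs
    by_cases hemp : (nb G s ∩ L) = ∅
    · rw [hemp]; simp; omega
    obtain ⟨b, hb⟩ := nonempty_iff_ne_empty.2 hemp
    rw [mem_inter, mem_nb] at hb
    have hsub : (Q.erase s).erase u ⊆ nb G s \ L := by
      intro q hq
      simp only [mem_erase] at hq
      rw [mem_sdiff, mem_nb]
      refine ⟨hsq b hb.2 s hb.1.symm q hq.2.2 hq.2.1 hq.1, fun h => ?_⟩
      rcases htop q hq.2.2 with h' | h'
      · exact hq.1 h'
      · exact (memL q h).2.2 h'
    have h1 := card_le_card hsub
    have h2 := card_sdiff_add_card_inter (nb G s) L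
    have h3 : (Q.erase s).card ≤ ((Q.erase s).erase u).card + 1 := by
      have := pred_card_le_card_erase (s := Q.erase s) (a := u)
      omega
    by_cases hsA : s ∈ A
    · have h4 := hAf s hsA
      rw [erase_eq_of_notMem (fun h => (hQ s h).1 hsA)] at *
      simp only [dz] at h4
      omega
    · have h4 := hO s hsA
      have h5 : Q.card ≤ (Q.erase s).card + 1 := by
        have := pred_card_le_card_erase (s := Q) (a := s)
        omega
      simp only [dz] at h4
      omega
  have hsplit : ∑ o ∈ Aᶜ, dz G o = ∑ o ∈ L, dz G o + ∑ o ∈ Aᶜ ∩ insert u (nb G u), dz G o := by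
    rw [hL, ← sum_union]
    · rw [sdiff_union_inter]
    · exact disjoint_sdiff_inter _ _
  have hs1 : ∑ o ∈ L, dz G o ≤ m * (t + 4) := by
    calc ∑ o ∈ L, dz G o = ∑ o ∈ L, ((nb G o ∩ T).card : ℤ) := by
          refine sum_congr rfl fun b hb => ?_
          rw [inter_eq_left.2 (hfar b hb).2, dz]
      _ = ∑ s ∈ T, ((nb G s ∩ L).card : ℤ) := sum_dz_symm _ _ _
      _ ≤ ∑ s ∈ T, (t + 4) := sum_le_sum hdegL
      _ = T.card * (t + 4) := by simp
      _ ≤ m * (t + 4) := by gcongr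
  have hs2 : ∑ o ∈ Aᶜ ∩ insert u (nb G u), dz G o ≤ m * m := by
    calc ∑ o ∈ Aᶜ ∩ insert u (nb G u), dz G o ≤ ∑ o ∈ Aᶜ ∩ insert u (nb G u), m := by
          refine sum_le_sum fun o ho => hO o ?_
          simpa using (mem_inter.1 ho).1
      _ = (Aᶜ ∩ insert u (nb G u)).card * m := by simp
      _ ≤ m * m := by
          gcongr
          refine le_trans ?_ hNu
          rw [Nat.cast_le]
          refine card_le_card fun o ho => ?_
          simp only [mem_inter, mem_compl] at ho
          rw [mem_erase]
          exact ⟨fun h => ho.1 (h ▸ hx), ho.2⟩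
  linarith

lemma shift_pair (hA : Ind A G) {q : V} (hq : q ∉ A) (htop : ∀ o ∉ A, dz G o ≤ dz G q) {x z : V}
    (hx : x ∈ A) (hz : z ∈ A) (hx1 : 1 ≤ dz G x) (hzq : ¬ G.Adj z q) :
    IndepReal A (dz G - dl x + dl z) := by
  by_cases hmove : ∃ u, G.Adj x u ∧ ¬ G.Adj z u
  · obtain ⟨u, hxu, hzu⟩ := hmove
    have hu : u ∉ A := fun h => hA _ hx _ h hxu
    have hzu' : z ≠ u := fun h => hu (h ▸ hz)
    refine ⟨addE (delE G x u) z u, ?_, ?_⟩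
    · intro a ha b hb
      have := hA a ha b hb
      simp only [adj_addE, adj_delE]
      grind
    · rw [dz_addE hzu', dz_delE hxu]
      · abel
      · simp only [adj_delE]; grind
  · push Not at hmove
    obtain ⟨u, hxu⟩ := exists_nb_of_pos hx1
    have hu : u ∉ A := fun h => hA _ hx _ h hxu
    have hxq : ¬ G.Adj x q := fun h => hzq (hmove q h)
    have hqx : ¬ G.Adj q x := fun h => hxq h.symm
    have hqz : ¬ G.Adj q z := fun h => hzq h.symm
    have hux := hxu.symm
    obtain ⟨c, hqc, huc, hcu⟩ := exists_nb_of_dz_le (htop u hu) hux hqx (fun h => hq (h ▸ hx))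
    have hcu' : ¬ G.Adj c u := fun h => huc h.symm
    have hzq' : z ≠ q := fun h => hq (h ▸ hz)
    have hcq := hqc.symm
    refine ⟨addE (addE (delE (delE G x u) q c) z q) u c, ?_, ?_⟩
    · intro a ha b hb
      have := hA a ha b hb
      simp only [adj_addE, adj_delE]
      grind
    · rw [dz_addE hcu.symm, dz_addE hzq', dz_delE, dz_delE hxu]
      · abel
      · simp only [adj_delE]; grind
      · simp only [adj_delE]; grind
      · simp only [adj_addE, adj_delE]; grind

lemma reach {Q : Finset V} {t m : ℤ} (ht : 0 ≤ t) (hQm : m ≤ Q.card + t + 2) (g : V → ℤ)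
    (hO : ∀ o ∉ A, g o ≤ m) (hQ : ∀ q ∈ Q, q ∉ A ∧ g q = m)
    (hbig : (Q.card : ℤ) ≤ m → m * (t + 4) + m * m < ∑ o ∈ Aᶜ, g o)
    (hg0 : ∀ a ∈ A, 0 ≤ g a) (hgQ : ∀ a ∈ A, g a ≤ Q.card) (N : ℕ) :
    ∀ e : V → ℤ, IndepReal A e → (∀ o ∉ A, e o = g o) → (∀ a ∈ A, e a ≤ Q.card + t + 2) →
      ∑ a ∈ A, g a ≤ ∑ a ∈ A, e a → Even (∑ a ∈ A, e a - ∑ a ∈ A, g a) →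
      ∑ a ∈ A, |e a - g a| < N → IndepReal A g := by
  induction N with
  | zero =>
    intro e _ _ _ _ _ h
    have : 0 ≤ ∑ a ∈ A, |e a - g a| := sum_nonneg fun _ _ => abs_nonneg _
    simp at h; omega
  | succ N ih =>
    intro e he heO heA hsum heven hN
    obtain ⟨G, hG, rfl⟩ := he
    have htop : ∀ q ∈ Q, ∀ o ∉ A, dz G o ≤ dz G q := by
      intro q hq o ho
      rw [heO o ho, heO q (hQ q hq).1, (hQ q hq).2]
      exact hO o ho
    by_cases hdef : ∃ z ∈ A, dz G z < g z
    · obtain ⟨z, hz, hzlt⟩ := hdef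
      obtain ⟨x, hx, hxlt⟩ : ∃ x ∈ A, g x < dz G x := by
        by_contra! h
        exact absurd (sum_lt_sum h ⟨z, hz, hzlt⟩) (not_lt.2 hsum)
      have hxz : x ≠ z := by rintro rfl; omega
      obtain ⟨q, hq, hzq⟩ : ∃ q ∈ Q, ¬ G.Adj z q := by
        by_contra! h
        have : Q ⊆ nb G z := fun q hq => by simpa using h q hq
        have := card_le_card this
        have := hgQ z hz
        simp only [dz] at hzlt
        omega
      have hre := shift_pair hG (hQ q hq).1 (htop q hq) hx hz
        (by have := hg0 x hx; omega) hzq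
      have hsum' : ∑ a ∈ A, (dz G - dl x + dl z) a = ∑ a ∈ A, dz G a := by
        simp only [Pi.add_apply, Pi.sub_apply, sum_add_distrib, sum_sub_distrib, sum_dl hx,
          sum_dl hz]
        ring
      refine ih _ hre ?_ ?_ ?_ ?_ ?_
      · intro o ho
        have h1 : o ≠ x := fun h => ho (h ▸ hx)
        have h2 : o ≠ z := fun h => ho (h ▸ hz)
        simp [dl_ne h1, dl_ne h2, heO o ho]
      · intro a ha
        have h1 := heA a ha
        have h2 := dl_nonneg x a
        have h3 := hgQ z hz
        simp only [Pi.add_apply, Pi.sub_apply]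
        by_cases h : a = z
        · subst h
          rw [dl_self]; omega
        · rw [dl_ne h]; omega
      · rw [hsum']; exact hsum
      · rw [hsum']; exact heven
      · refine lt_of_lt_of_le (sum_lt_sum (g := fun a => |dz G a - g a|) ?_ ⟨x, hx, ?_⟩)
          (by push_cast at hN; omega)
        · intro a ha
          simp only [Pi.add_apply, Pi.sub_apply, dl]
          split_ifs with h1 h2 h2
          · exact absurd (h1.symm.trans h2) hxz
          · subst h1; rw [abs_of_pos (by omega : 0 < dz G a - g a), abs_le]; omega
          · subst h2; rw [abs_of_neg (by omega : dz G a - g a < 0), abs_le]; omega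
          · simp
        · simp only [Pi.add_apply, Pi.sub_apply, dl_self, dl_ne hxz]
          rw [abs_of_pos (by omega : 0 < dz G x - g x), abs_lt]; omega
    · push Not at hdef
      by_cases heq : ∀ a ∈ A, dz G a = g a
      · refine ⟨G, hG, funext fun v => ?_⟩
        by_cases hv : v ∈ A
        · exact heq v hv
        · exact heO v hv
      push Not at heq
      obtain ⟨x, hx, hne⟩ := heq
      have hxlt : g x < dz G x := lt_of_le_of_ne (hdef x hx) (Ne.symm hne)
      obtain ⟨y, hy, hylt, hxy⟩ : ∃ y ∈ A, g y < dz G y ∧ (x = y → g x + 2 ≤ dz G x) := by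
        by_cases h2 : g x + 2 ≤ dz G x
        · exact ⟨x, hx, hxlt, fun _ => h2⟩
        by_contra! h
        have h3 : ∀ a ∈ A, dz G a - g a = dl x a := by
          intro a ha
          by_cases hax : a = x
          · subst hax; rw [dl_self]; omega
          · rw [dl_ne hax]
            have := hdef a ha
            by_contra h4
            exact hax (h a ha (by omega)).1.symm
        rw [← sum_sub_distrib, sum_congr rfl h3, sum_dl hx] at heven
        exact absurd heven (by decide)
      have hre := free_pair hG (Q := Q) (t := t) (m := m) ht
        (fun o ho => (heO o ho).trans_le (hO o ho))
        (fun q hq => ⟨(hQ q hq).1, (heO q (hQ q hq).1).trans (hQ q hq).2⟩) hQm heA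
        (fun h => by
          rw [sum_congr rfl fun o ho => heO o (by simpa using ho)]
          exact hbig h) hx hy
        (by have := hg0 x hx; omega) (by have := hg0 y hy; omega)
        (fun h => by have := hg0 x hx; have := hxy h; omega)
      have hle : ∀ a ∈ A, g a ≤ (dz G - dl x - dl y) a ∧ (dz G - dl x - dl y) a ≤ dz G a := by
        intro a ha
        have := hdef a ha
        simp only [Pi.sub_apply, dl]
        split_ifs with h1 h2 h2
        · subst h1; subst h2; have := hxy rfl; omega
        · subst h1; omega
        · subst h2; omega
        · omega
      have hsum' : ∑ a ∈ A, (dz G - dl x - dl y) a = ∑ a ∈ A, dz G a - 2 := by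
        simp only [Pi.sub_apply, sum_sub_distrib, sum_dl hx, sum_dl hy]
        ring
      refine ih _ hre ?_ ?_ ?_ ?_ ?_
      · intro o ho
        have h1 : o ≠ x := fun h => ho (h ▸ hx)
        have h2 : o ≠ y := fun h => ho (h ▸ hy)
        simp [dl_ne h1, dl_ne h2, heO o ho]
      · exact fun a ha => (hle a ha).2.trans (heA a ha)
      · exact sum_le_sum fun a ha => (hle a ha).1
      · rw [hsum']
        obtain ⟨k, hk⟩ := heven
        exact ⟨k - 1, by omega⟩
      · have h1 : ∑ a ∈ A, |(dz G - dl x - dl y) a - g a| = ∑ a ∈ A, |dz G a - g a| - 2 := by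
          rw [sum_congr rfl fun a ha => abs_of_nonneg (sub_nonneg.2 (hle a ha).1),
            sum_congr rfl fun a ha => abs_of_nonneg (sub_nonneg.2 (hdef a ha)),
            sum_sub_distrib, sum_sub_distrib, hsum']
          ring
        rw [h1]; push_cast at hN; omega

end Flat

/-- The edges of `G` inside `A`. -/
def inE {V : Type*} (A : Finset V) (G : SimpleGraph V) : SimpleGraph V where
  Adj x y := G.Adj x y ∧ x ∈ A ∧ y ∈ A
  symm := ⟨fun _ _ h => ⟨h.1.symm, h.2.2, h.2.1⟩⟩
  loopless := ⟨fun _ h => h.1.ne rfl⟩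

/-- The edges of `G` not inside `A`. -/
def outE {V : Type*} (A : Finset V) (G : SimpleGraph V) : SimpleGraph V where
  Adj x y := G.Adj x y ∧ ¬ (x ∈ A ∧ y ∈ A)
  symm := ⟨fun _ _ h => ⟨h.1.symm, fun h' => h.2 h'.symm⟩⟩
  loopless := ⟨fun _ h => h.1.ne rfl⟩

/-- All edges of `H` are inside `A`. -/
def Inside {V : Type*} (A : Finset V) (H : SimpleGraph V) : Prop :=
  ∀ x y, H.Adj x y → x ∈ A ∧ y ∈ A

section Merge
variable {V : Type*} {A : Finset V} {G H : SimpleGraph V}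

lemma ind_outE : Ind A (outE A G) := fun _ ha _ hb h => h.2 ⟨ha, hb⟩

lemma inside_inE : Inside A (inE A G) := fun _ _ h => h.2

variable [Fintype V]

lemma dz_sup (h : ∀ x y, G.Adj x y → ¬ H.Adj x y) : dz (G ⊔ H) = dz G + dz H := by
  funext v
  have : nb (G ⊔ H) v = nb G v ∪ nb H v := by ext; simp
  simp only [dz, Pi.add_apply, this]
  rw [card_union_of_disjoint]
  · simp
  · rw [Finset.disjoint_left]
    intro x hx
    simpa using h v x (by simpa using hx)

lemma dz_merge (hG : Ind A G) (hH : Inside A H) : dz (G ⊔ H) = dz G + dz H :=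
  dz_sup fun _ _ h h' => hG _ (hH _ _ h').1 _ (hH _ _ h').2 h

lemma dz_out_add_in (A : Finset V) (G : SimpleGraph V) : dz G = dz (outE A G) + dz (inE A G) := by
  rw [← dz_merge ind_outE inside_inE]
  congr 1
  ext x y
  simp only [sup_adj, outE, inE]
  tauto

lemma dz_inside_off (hH : Inside A H) {v : V} (hv : v ∉ A) : dz H v = 0 := by
  simp only [dz, Nat.cast_eq_zero, card_eq_zero, eq_empty_iff_forall_notMem, mem_nb]
  exact fun x h => hv (hH _ _ h).1

lemma dz_inside_le (hH : Inside A H) {v : V} (hv : v ∈ A) : dz H v ≤ A.card - 1 := by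
  have : nb H v ⊆ A.erase v := fun x hx => by
    rw [mem_nb] at hx
    exact mem_erase.2 ⟨hx.ne', (hH _ _ hx).2⟩
  have := card_le_card this
  rw [card_erase_of_mem hv] at this
  have : 0 < A.card := card_pos.2 ⟨v, hv⟩
  simp only [dz]
  omega

lemma exists_nonadj_of_dz_lt {v : V} (hv : v ∈ A) (h : dz H v < A.card - 1) :
    ∃ w ∈ A, w ≠ v ∧ ¬ H.Adj v w := by
  by_contra! hcon
  have : A.erase v ⊆ nb H v := fun x hx => by
    rw [mem_erase] at hx
    simpa using hcon x hx.2 hx.1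
  have := card_le_card this
  rw [card_erase_of_mem hv] at this
  simp only [dz] at h
  omega

lemma even_sum_dz (G : SimpleGraph V) : Even (∑ v, dz G v) := by
  have h := G.sum_degrees_eq_twice_card_edges
  have : ∑ v, dz G v = ((∑ v, G.degree v : ℕ) : ℤ) := by
    rw [Nat.cast_sum]
    exact sum_congr rfl fun v _ => by rw [dz, nb_card_degree]
  rw [this, h]
  simp

lemma even_sum_dz_inside (hH : Inside A H) : Even (∑ a ∈ A, dz H a) := by
  have h := even_sum_dz H
  rwa [← sum_subset (subset_univ A) fun v _ hv => dz_inside_off hH hv] at h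

lemma dz_lt_of_nonadj (hH : Inside A H) {x y : V} (hx : x ∈ A) (hy : y ∈ A) (hxy : x ≠ y)
    (h : ¬ H.Adj x y) : dz H x ≤ A.card - 2 := by
  have : nb H x ⊆ (A.erase x).erase y := fun z hz => by
    rw [mem_nb] at hz
    refine mem_erase.2 ⟨?_, mem_erase.2 ⟨hz.ne', (hH _ _ hz).2⟩⟩
    rintro rfl
    exact h hz
  have := card_le_card this
  rw [card_erase_of_mem (mem_erase.2 ⟨hxy.symm, hy⟩), card_erase_of_mem hx] at this
  have : 1 < A.card := one_lt_card.2 ⟨x, hx, y, hy, hxy⟩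
  simp only [dz]
  omega

lemma dense_complete (hH : Inside A H) {Q : Finset V} {t m : ℤ} {e : V → ℤ} (ht : 0 ≤ t)
    (hcard : (A.card : ℤ) = t + 4) (hm : 2 * t + 5 ≤ m) (he : IndepReal A e)
    (hQ : ∀ q ∈ Q, q ∉ A ∧ e q = m) (hO : ∀ o ∉ A, o ∉ Q → e o ≤ m - 1)
    (hlow : ∀ a ∈ A, m ≤ e a + dz H a) (hflat : ∀ a ∈ A, e a + dz H a ≤ Q.card + t + 2)
    (hblk : ∀ x ∈ A, ∀ y ∈ A, x ≠ y → ¬ H.Adj x y → ¬ IndepReal A (e - dl x - dl y)) :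
    ∀ x ∈ A, ∀ y ∈ A, x ≠ y → H.Adj x y := by
  by_contra! hcon
  obtain ⟨x, hx, y, hy, hxy, hnadj⟩ := hcon
  obtain ⟨G, ⟨hA, hGe⟩, hmax⟩ := exists_max_graph (fun G => Ind A G ∧ dz G = e)
    (fun G => ∑ q ∈ Q, (nb G q ∩ A).card) he
  have hOm : ∀ o ∉ A, e o ≤ m := fun o ho => by
    by_cases hoQ : o ∈ Q
    · exact (hQ o hoQ).2.le
    · have := hO o ho hoQ; omega
  have hmQ : m ≤ Q.card + t + 2 := (hlow x hx).trans (hflat x hx)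
  have hpos : ∀ a ∈ A, 1 ≤ e a := fun a ha => by
    have := hlow a ha
    have := dz_inside_le hH ha
    omega
  have hcl : ∀ G' : SimpleGraph V, Ind A G' → dz G' = e → ∀ x ∈ A, ∀ y ∈ A, x ≠ y → ¬ H.Adj x y →
      ∀ u, G'.Adj x u → ∀ q ∈ Q, q = u ∨ G'.Adj u q := by
    intro G' hA' he' x hx y hy hxy hn u hxu q hq
    obtain ⟨w, hw⟩ := exists_nb_of_pos (G := G') (x := y) (by rw [he']; exact hpos y hy)
    refine blocked_top hA' hx hy hxu hw (fun h => absurd h hxy) ?_ (hQ q hq).1 ?_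
    · rw [he']; exact hblk x hx y hy hxy hn
    · rw [he', (hQ q hq).2]; exact hOm
  obtain ⟨u, hxu⟩ := exists_nb_of_pos (G := G) (x := x) (by rw [hGe]; exact hpos x hx)
  have hu : u ∉ A := fun h => hA _ hx _ h hxu
  have hQcl : ∀ z ∈ Q, ∀ z' ∈ Q, z ≠ z' → G.Adj z z' := by
    intro z hz z' hz' hne
    by_contra hzz
    have hzA := (hQ z hz).1
    have hz'A := (hQ z' hz').1
    have hxz : ¬ G.Adj x z := fun h => by
      rcases hcl G hA hGe x hx y hy hxy hnadj z h z' hz' with h' | h'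
      · exact hne h'.symm
      · exact hzz h'
    have huz : z ≠ u := fun h => hxz (h ▸ hxu)
    have huz' : z' ≠ u := fun h => by
      rcases hcl G hA hGe x hx y hy hxy hnadj u hxu z hz with h' | h'
      · exact huz h'
      · exact hzz (h ▸ h'.symm)
    have huadj := (hcl G hA hGe x hx y hy hxy hnadj u hxu z' hz').resolve_left huz'
    obtain ⟨c, hzc, huc, hcu⟩ := exists_nb_of_dz_le (G := G) (o := u) (k := z) (p := x)
      (by rw [hGe, (hQ z hz).2]; exact hOm u hu) hxu.symm (fun h => hxz h.symm)
      (fun h => hzA (h ▸ hx))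
    have hcu' : ¬ G.Adj c u := fun h => huc h.symm
    have hdz := dz_switch hzc huadj.symm hzz hcu' hne hcu
    have hadj := fun x y => adj_switch G z c z' u x y hne hcu
    have hthis := hcl (switch G z c z' u) ?_ (hdz.trans hGe) x hx y hy hxy hnadj u ?_ z' hz'
    · rw [hadj] at hthis
      grind
    · intro a ha b hb
      have := hA a ha b hb
      rw [hadj]; grind
    · rw [hadj]; grind
  have hdeg : ∀ v, ((nb G v).card : ℤ) = e v := fun v => by rw [← hGe, dz]
  have hBQ : ∀ c, c ∉ A → c ∉ Q → ((nb G c ∩ A).card : ℤ) ≤ (nb G c ∩ Q).card := by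
    intro c hcA hcQ
    by_cases hemp : (nb G c ∩ A) = ∅
    · rw [hemp]; simp
    obtain ⟨a, ha⟩ := nonempty_iff_ne_empty.2 hemp
    rw [mem_inter, mem_nb] at ha
    obtain ⟨hca, ha⟩ := ha
    have hNQ : Q.card ≤ (nb G c ∩ Q).card + 1 := by
      by_cases hcomp : ∃ q ∈ Q, ¬ G.Adj a q
      · obtain ⟨q, hq, haq⟩ := hcomp
        have hqA := (hQ q hq).1
        have hqc : q ≠ c := fun h => hcQ (h ▸ hq)
        have haq' : a ≠ q := fun h => hqA (h ▸ ha)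
        have hsub : Q.erase q ⊆ nb G c ∩ Q := by
          intro z hz
          rw [mem_erase] at hz
          rw [mem_inter, mem_nb]
          refine ⟨?_, hz.2⟩
          by_contra hcz
          have hzA := (hQ z hz.2).1
          have hqz := hQcl q hq z hz.2 hz.1.symm
          have hcz' : c ≠ z := fun h => hcQ (h ▸ hz.2)
          have hdz := dz_switch hca.symm hqz haq hcz haq' hcz'
          have hadj := fun x y => adj_switch G a c q z x y haq' hcz'
          have hle := hmax (switch G a c q z) ⟨?_, hdz.trans hGe⟩
          · refine absurd hle (not_le.2 (sum_lt_sum ?_ ⟨q, hq, ?_⟩))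
            · intro p hp
              refine card_le_card fun b hb => ?_
              rw [mem_inter, mem_nb] at hb ⊢
              rw [hadj]
              have := (hQ p hp).1
              grind
            · refine card_lt_card ((ssubset_iff_of_subset ?_).2 ⟨a, ?_, ?_⟩)
              · intro b hb
                rw [mem_inter, mem_nb] at hb ⊢
                rw [hadj]
                grind
              · rw [mem_inter, mem_nb, hadj]; grind
              · rw [mem_inter, mem_nb]
                exact fun h => haq h.1.symm
          · intro a ha b hb
            have := hA a ha b hb
            rw [hadj]; grind
        have h1 := card_le_card hsub
        rw [card_erase_of_mem hq] at h1
        omega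
      · push Not at hcomp
        have hsub : insert c Q ⊆ nb G a := by
          intro z hz
          rw [mem_nb]
          rcases mem_insert.1 hz with rfl | h
          · exact hca.symm
          · exact hcomp z h
        have h1 := card_le_card hsub
        rw [card_insert_of_notMem hcQ] at h1
        have h2 := hdeg a
        have h3 := hflat a ha
        obtain ⟨a', ha', hne, hnad⟩ := exists_nonadj_of_dz_lt (H := H) ha (by omega)
        have hsub2 : Q ⊆ nb G c ∩ Q := by
          intro q hq
          rw [mem_inter, mem_nb]
          refine ⟨?_, hq⟩
          exact (hcl G hA hGe a ha a' ha' hne.symm hnad c hca.symm q hq).resolve_left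
            (fun h => hcQ (h ▸ hq))
        have := card_le_card hsub2
        omega
    have hdis : (nb G c ∩ A).card + (nb G c ∩ Q).card ≤ (nb G c).card := by
      rw [← card_union_of_disjoint]
      · exact card_le_card (union_subset inter_subset_left inter_subset_left)
      · rw [Finset.disjoint_left]
        intro z hz hz'
        exact (hQ z (mem_inter.1 hz').2).1 (mem_inter.1 hz).2
    have h1 := hdeg c
    have h2 := hO c hcA hcQ
    omega
  have hQout : ∀ q ∈ Q, ((nb G q ∩ A).card : ℤ) + (nb G q ∩ (Aᶜ \ Q)).card = m + 1 - Q.card := by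
    intro q hq
    have h1 : nb G q = (nb G q ∩ A) ∪ (nb G q ∩ (Aᶜ \ Q)) ∪ Q.erase q := by
      ext z
      have h2 := hQcl q hq z
      have h3 := hQ z
      simp only [mem_union, mem_inter, mem_nb, mem_sdiff, mem_compl, mem_erase]
      have : z = q → ¬ G.Adj q z := by rintro rfl; exact G.irrefl
      grind
    have h2 := congrArg card h1
    have hq0 : 0 < Q.card := card_pos.2 ⟨q, hq⟩
    rw [card_union_of_disjoint, card_union_of_disjoint, card_erase_of_mem hq] at h2
    · have := hdeg q
      rw [(hQ q hq).2] at this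
      omega
    · rw [Finset.disjoint_left]; intro z; simp only [mem_inter, mem_sdiff, mem_compl]; tauto
    · rw [Finset.disjoint_left]; intro z
      have := hQ z
      simp only [mem_inter, mem_sdiff, mem_compl, mem_erase, mem_union]; tauto
  have hup : ∑ a ∈ A, e a ≤ Q.card * (m + 1 - Q.card) := by
    calc ∑ a ∈ A, e a = ∑ a ∈ A, ((nb G a ∩ Aᶜ).card : ℤ) := by
          refine sum_congr rfl fun a ha => ?_
          rw [← hdeg, inter_eq_left.2]
          intro z hz
          rw [mem_nb] at hz
          exact mem_compl.2 fun h => hA a ha z h hz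
      _ = ∑ o ∈ Aᶜ, ((nb G o ∩ A).card : ℤ) := sum_dz_symm _ _ _
      _ = ∑ q ∈ Q, ((nb G q ∩ A).card : ℤ) + ∑ c ∈ Aᶜ \ Q, ((nb G c ∩ A).card : ℤ) := by
          rw [add_comm, sum_sdiff]
          exact fun q hq => mem_compl.2 (hQ q hq).1
      _ ≤ ∑ q ∈ Q, ((nb G q ∩ A).card : ℤ) + ∑ c ∈ Aᶜ \ Q, ((nb G c ∩ Q).card : ℤ) := by
          refine add_le_add_right (sum_le_sum fun c hc => ?_) _
          simp only [mem_sdiff, mem_compl] at hc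
          exact hBQ c hc.1 hc.2
      _ = ∑ q ∈ Q, (((nb G q ∩ A).card : ℤ) + (nb G q ∩ (Aᶜ \ Q)).card) := by
          rw [sum_add_distrib, sum_dz_symm G (Aᶜ \ Q) Q]
      _ = Q.card * (m + 1 - Q.card) := by
          rw [sum_congr rfl hQout, sum_const, nsmul_eq_mul]
  have hdown : (t + 4) * (m - t - 3) + 2 ≤ ∑ a ∈ A, e a := by
    have h1 : ∀ a ∈ A, (m - t - 3) + dl x a + dl y a ≤ e a := by
      intro a ha
      have h2 := hlow a ha
      by_cases hax : a = x
      · subst hax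
        have := dz_lt_of_nonadj hH ha hy hxy hnadj
        rw [dl_self, dl_ne hxy]; omega
      · by_cases hay : a = y
        · subst hay
          have := dz_lt_of_nonadj hH ha hx hax (fun h => hnadj h.symm)
          rw [dl_self, dl_ne hax]; omega
        · have := dz_inside_le hH ha
          rw [dl_ne hax, dl_ne hay]; omega
    have h2 := sum_le_sum h1
    rw [sum_add_distrib, sum_add_distrib, sum_dl hx, sum_dl hy] at h2
    simp only [sum_const, nsmul_eq_mul, hcard] at h2
    linarith
  nlinarith [mul_nonneg (sub_nonneg.2 hmQ) (by linarith : (0 : ℤ) ≤ Q.card - t - 3)]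

end Merge

/-- All nonadjacent pairs of `G` inside `A` are edges of `P`. -/
def Miss {V : Type*} (A : Finset V) (G P : SimpleGraph V) : Prop :=
  ∀ x ∈ A, ∀ y ∈ A, x ≠ y → ¬ G.Adj x y → P.Adj x y

section Realize
variable {V : Type*} [Fintype V] {A : Finset V} {G : SimpleGraph V}

lemma flat_dense {Q : Finset V} {t m : ℤ} (ht : 0 ≤ t)
    (hcard : (A.card : ℤ) = t + 4) (hm : 2 * t + 5 ≤ m)
    (hQ : ∀ q ∈ Q, q ∉ A ∧ dz G q = m) (hO : ∀ o ∉ A, o ∉ Q → dz G o ≤ m - 1)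
    (hlow : ∀ a ∈ A, m ≤ dz G a) (hflat : ∀ a ∈ A, dz G a ≤ Q.card + t + 2) :
    ∃ G', dz G' = dz G ∧ ∀ x ∈ A, ∀ y ∈ A, x ≠ y → G'.Adj x y := by
  obtain ⟨G', hd, hmax⟩ := exists_max_graph (fun G' => dz G' = dz G)
    (fun G' => ∑ a ∈ A, (nb G' a ∩ A).card) ⟨G, rfl⟩
  refine ⟨G', hd, ?_⟩
  have hsplit : ∀ v, dz (outE A G') v + dz (inE A G') v = dz G v := fun v => by
    rw [← hd, dz_out_add_in A G', Pi.add_apply]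
  have hoff : ∀ v, v ∉ A → dz (outE A G') v = dz G v := fun v hv => by
    have := hsplit v
    rwa [dz_inside_off inside_inE hv, add_zero] at this
  have := dense_complete (A := A) (H := inE A G') inside_inE ht hcard hm ⟨_, ind_outE, rfl⟩
    (fun q hq => ⟨(hQ q hq).1, (hoff q (hQ q hq).1).trans (hQ q hq).2⟩)
    (fun o ho hoQ => (hoff o ho).trans_le (hO o ho hoQ))
    (fun a ha => by rw [hsplit]; exact hlow a ha)
    (fun a ha => by rw [hsplit]; exact hflat a ha) ?_
  · exact fun x hx y hy hxy => (this x hx y hy hxy).1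
  intro x hx y hy hxy hnadj hre
  obtain ⟨G₁, hA₁, hd₁⟩ := hre
  have hnadj' : ¬ G'.Adj x y := fun h => hnadj ⟨h, hx, hy⟩
  have hin : Inside A (addE (inE A G') x y) := by
    intro a b hab
    rw [adj_addE] at hab
    rcases hab with h | h
    · exact h.2
    · grind
  have hle := hmax (G₁ ⊔ addE (inE A G') x y) (by
    rw [dz_merge hA₁ hin, dz_addE hxy hnadj, hd₁, ← hd, dz_out_add_in A G']
    abel)
  have hmono : ∀ a ∈ A, nb G' a ∩ A ⊆ nb (G₁ ⊔ addE (inE A G') x y) a ∩ A := by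
    intro a ha b hb
    rw [mem_inter, mem_nb] at hb ⊢
    refine ⟨Or.inr ?_, hb.2⟩
    rw [adj_addE]
    exact Or.inl ⟨hb.1, ha, hb.2⟩
  refine absurd hle (not_le.2 (sum_lt_sum (fun a ha => card_le_card (hmono a ha)) ⟨x, hx, ?_⟩))
  refine card_lt_card ((ssubset_iff_of_subset (hmono x hx)).2 ⟨y, ?_, ?_⟩)
  · rw [mem_inter, mem_nb]
    refine ⟨Or.inr ?_, hy⟩
    rw [adj_addE]; grind
  · rw [mem_inter, mem_nb]; exact fun h => hnadj' h.1

lemma dz_inE_top {a : V} (ha : a ∈ A) : dz (inE A ⊤) a = A.card - 1 := by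
  have : nb (inE A ⊤) a = A.erase a := by
    ext x
    simp only [mem_nb, inE, mem_erase, top_adj]
    grind
  rw [dz, this, card_erase_of_mem ha]
  have : 0 < A.card := card_pos.2 ⟨a, ha⟩
  omega

lemma dz_compl_add {P : SimpleGraph V} (hP : Inside A P) :
    dz (inE A ⊤ \ P) + dz P = dz (inE A ⊤) := by
  rw [← dz_sup]
  · congr 1
    ext x y
    have := hP x y
    have : P.Adj x y → x ≠ y := fun h => h.ne
    simp only [sup_adj, sdiff_adj, inE, top_adj]
    tauto
  · intro x y h; exact h.2

lemma realize_of_missing {P : SimpleGraph V} (hP : Inside A P) {Q : Finset V} {t m : ℤ} (ht : 0 ≤ t)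
    (hcard : (A.card : ℤ) = t + 4) (hO : ∀ o ∉ A, dz G o ≤ m)
    (hQ : ∀ q ∈ Q, q ∉ A ∧ dz G q = m) (hQm : m ≤ Q.card + t + 2)
    (hbig : (Q.card : ℤ) ≤ m → m * (t + 4) + m * m < ∑ o ∈ Aᶜ, dz G o)
    (hflat : ∀ a ∈ A, dz G a ≤ Q.card + t + 2)
    (hlow : ∀ a ∈ A, t + 3 ≤ dz G a + dz P a) (hup : ∀ a ∈ A, dz G a + dz P a ≤ Q.card + t + 3)
    (hsum : ∑ a ∈ A, dz P a ≤ ∑ a ∈ A, dz (inE A ⊤ \ inE A G) a) :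
    ∃ G', dz G' = dz G ∧ Miss A G' P := by
  set H : SimpleGraph V := inE A ⊤ \ P with hH
  have hHin : Inside A H := fun x y h => h.1.2
  have hHdz : ∀ a ∈ A, dz H a = t + 3 - dz P a := fun a ha => by
    have h := congrFun (dz_compl_add hP) a
    rw [Pi.add_apply, ← hH, dz_inE_top ha] at h
    omega
  have hIdz : ∀ a ∈ A, dz (inE A ⊤ \ inE A G) a = t + 3 - dz (inE A G) a := fun a ha => by
    have h := congrFun (dz_compl_add (inside_inE (A := A) (G := G))) a
    rw [Pi.add_apply, dz_inE_top ha] at h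
    omega
  rw [sum_congr rfl hIdz, sum_sub_distrib] at hsum
  have hsplit : ∀ v, dz (outE A G) v + dz (inE A G) v = dz G v := fun v => by
    conv_rhs => rw [dz_out_add_in A G, Pi.add_apply]
  have hsH : ∑ a ∈ A, dz H a = ∑ a ∈ A, (t + 3) - ∑ a ∈ A, dz P a := by
    rw [sum_congr rfl hHdz, sum_sub_distrib]
  have hsO : ∑ a ∈ A, dz G a = ∑ a ∈ A, dz (outE A G) a + ∑ a ∈ A, dz (inE A G) a := by
    rw [← sum_add_distrib]
    exact sum_congr rfl fun a _ => (hsplit a).symm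
  have hoff : ∀ v, v ∉ A → (dz G - dz H) v = dz G v := fun v hv => by
    rw [Pi.sub_apply, dz_inside_off hHin hv, sub_zero]
  have hgs : ∑ a ∈ A, (dz G - dz H) a = ∑ a ∈ A, dz G a - ∑ a ∈ A, dz H a := by
    simp only [Pi.sub_apply, sum_sub_distrib]
  have hre : IndepReal A (dz G - dz H) := by
    refine reach (Q := Q) (t := t) (m := m) ht hQm (dz G - dz H)
      (fun o ho => (hoff o ho).trans_le (hO o ho))
      (fun q hq => ⟨(hQ q hq).1, (hoff q (hQ q hq).1).trans (hQ q hq).2⟩) ?_ ?_ ?_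
      ((∑ a ∈ A, |dz (outE A G) a - (dz G - dz H) a|).toNat + 1) (dz (outE A G))
      ⟨_, ind_outE, rfl⟩ ?_ ?_ ?_ ?_ ?_
    · intro h
      rw [sum_congr rfl fun o ho => hoff o (by simpa using ho)]
      exact hbig h
    · intro a ha
      have := hHdz a ha
      have := hlow a ha
      rw [Pi.sub_apply]; omega
    · intro a ha
      have := hHdz a ha
      have := hup a ha
      rw [Pi.sub_apply]; omega
    · intro o ho
      rw [hoff o ho, ← hsplit o, dz_inside_off inside_inE ho, add_zero]
    · intro a ha
      have h1 := hsplit a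
      have h2 := dz_nonneg (inE A G) a
      have h3 := hflat a ha
      omega
    · rw [hgs]; omega
    · obtain ⟨k, hk⟩ := even_sum_dz_inside hHin
      obtain ⟨l, hl⟩ := even_sum_dz_inside (inside_inE (A := A) (G := G))
      exact ⟨k - l, by rw [hgs]; omega⟩
    · push_cast
      have := Int.self_le_toNat (∑ a ∈ A, |dz (outE A G) a - (dz G - dz H) a|)
      omega
  obtain ⟨G₁, hA₁, hd₁⟩ := hre
  refine ⟨G₁ ⊔ H, ?_, ?_⟩
  · rw [dz_merge hA₁ hHin, hd₁]; abel
  · intro x hx y hy hxy hn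
    by_contra hP'
    exact hn (Or.inr ⟨⟨hxy, hx, hy⟩, hP'⟩)

lemma realize_of_missing_on {J : Finset V} (hJ : J ⊆ A) {P : SimpleGraph V} (hP : Inside J P)
    {Q : Finset V} {t m : ℤ} (ht : 0 ≤ t)
    (hcard : (A.card : ℤ) = t + 4) (hO : ∀ o ∉ A, dz G o ≤ m)
    (hQ : ∀ q ∈ Q, q ∉ A ∧ dz G q = m) (hQm : m ≤ Q.card + t + 2)
    (hbig : (Q.card : ℤ) ≤ m → m * (t + 4) + m * m < ∑ o ∈ Aᶜ, dz G o)
    (hflat : ∀ a ∈ A, dz G a ≤ Q.card + t + 2)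
    (hJP : ∀ a ∈ J, t + 3 ≤ dz G a + dz P a ∧ dz G a + dz P a ≤ Q.card + t + 3)
    (hrest : ∀ a ∈ A, a ∉ J → t + 3 ≤ dz G a)
    (hsum : ∑ a ∈ J, dz P a ≤ ∑ a ∈ A, dz (inE A ⊤ \ inE A G) a) :
    ∃ G', dz G' = dz G ∧ Miss A G' P := by
  refine realize_of_missing (fun x y h => ⟨hJ (hP x y h).1, hJ (hP x y h).2⟩) ht hcard hO hQ hQm
    hbig hflat ?_ ?_ ?_
  · intro a ha
    by_cases h : a ∈ J
    · exact (hJP a h).1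
    · rw [dz_inside_off hP h]; have := hrest a ha h; omega
  · intro a ha
    by_cases h : a ∈ J
    · exact (hJP a h).2
    · rw [dz_inside_off hP h]; have := hflat a ha; omega
  · rwa [← sum_subset hJ fun v _ hv => dz_inside_off hP hv]

lemma sum_dz_le_of_crossing (G : SimpleGraph V) (J : Finset V) :
    ∑ v ∈ J, dz G v ≤ J.card * (J.card - 1) + ∑ v ∈ Jᶜ, dz G v := by
  have h1 : ∀ v ∈ J, dz G v ≤ (J.card - 1 : ℤ) + (nb G v ∩ Jᶜ).card := by
    intro v hv
    have hsub : nb G v ⊆ J.erase v ∪ (nb G v ∩ Jᶜ) := by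
      intro w hw
      rw [mem_nb] at hw
      have := hw.ne'
      simp only [mem_union, mem_erase, mem_inter, mem_nb, mem_compl]
      tauto
    have h2 := (card_le_card hsub).trans (card_union_le _ _)
    rw [card_erase_of_mem hv] at h2
    have : 0 < J.card := card_pos.2 ⟨v, hv⟩
    rw [dz]; omega
  refine (sum_le_sum h1).trans ?_
  rw [sum_add_distrib, sum_const, nsmul_eq_mul, sum_dz_symm]
  refine add_le_add_right (sum_le_sum fun v _ => ?_) _
  rw [dz, Nat.cast_le]
  exact card_le_card inter_subset_left

end Realize

/-- The paw: a triangle `pqr` with a pendant edge `ps`. -/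
def pawG {V : Type*} (p q r s : V) : SimpleGraph V :=
  addE (addE (addE (addE ⊥ p q) p r) p s) q r

/-- A path `pqr` together with an edge `su`. -/
def pathEdgeG {V : Type*} (p q r s u : V) : SimpleGraph V :=
  addE (addE (addE ⊥ p q) q r) s u

/-- The nonedges of `G` inside `A` are contained in a paw or in the disjoint union of a path with
two edges and an edge. -/
def Comp {V : Type*} (A : Finset V) (G : SimpleGraph V) : Prop :=
  (∃ p q r s, [p, q, r, s].Nodup ∧ (∀ v ∈ [p, q, r, s], v ∈ A) ∧ Miss A G (pawG p q r s)) ∨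
  (∃ p q r s u, [p, q, r, s, u].Nodup ∧ (∀ v ∈ [p, q, r, s, u], v ∈ A) ∧
    Miss A G (pathEdgeG p q r s u))

section Sparse
variable {V : Type*}

lemma exists_sorted_five (A : Finset V) (hA : 5 ≤ A.card) (f : V → ℤ) :
    ∃ a b c d e, [a, b, c, d, e].Nodup ∧ (∀ v ∈ [a, b, c, d, e], v ∈ A) ∧ f a ≤ f b ∧ f b ≤ f c ∧
      f c ≤ f d ∧ f d ≤ f e ∧ ∀ v ∈ A, v ∉ [a, b, c, d, e] → f e ≤ f v := by
  have hne : ∀ B : Finset V, 0 < B.card → ∃ x ∈ B, ∀ v ∈ B, f x ≤ f v := fun B hB =>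
    exists_min_image B f (card_pos.1 hB)
  obtain ⟨a, ha, ha'⟩ := hne A (by omega)
  have h1 := card_erase_of_mem ha
  obtain ⟨b, hb, hb'⟩ := hne (A.erase a) (by omega)
  have h2 := card_erase_of_mem hb
  obtain ⟨c, hc, hc'⟩ := hne ((A.erase a).erase b) (by omega)
  have h3 := card_erase_of_mem hc
  obtain ⟨d, hd, hd'⟩ := hne (((A.erase a).erase b).erase c) (by omega)
  have h4 := card_erase_of_mem hd
  obtain ⟨e, he, he'⟩ := hne ((((A.erase a).erase b).erase c).erase d) (by omega)
  simp only [mem_erase] at hb hc hd he hb' hc' hd' he'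
  refine ⟨a, b, c, d, e, ?_, ?_, ha' b (by tauto), hb' c (by tauto), hc' d (by tauto),
    hd' e (by tauto), ?_⟩
  · simp only [List.nodup_cons, List.mem_cons, List.not_mem_nil, or_false, not_or]
    grind
  · simp only [List.mem_cons, List.not_mem_nil, or_false]
    grind
  · intro v hv hv'
    simp only [List.mem_cons, List.not_mem_nil, or_false, not_or] at hv'
    exact he' v (by tauto)

variable {A S : Finset V} {G : SimpleGraph V}

lemma inside_addE {J : Finset V} {P : SimpleGraph V} (hP : Inside J P) {u v : V} (hu : u ∈ J)
    (hv : v ∈ J) : Inside J (addE P u v) := by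
  intro x y h
  rw [adj_addE] at h
  rcases h with h | ⟨-, ⟨rfl, rfl⟩ | ⟨rfl, rfl⟩⟩
  · exact hP x y h
  · exact ⟨hu, hv⟩
  · exact ⟨hv, hu⟩

lemma inside_bot {J : Finset V} : Inside J (⊥ : SimpleGraph V) := fun _ _ h => h.elim

lemma Miss.mono {P P' : SimpleGraph V} (h : Miss A G P) (hP : ∀ x y, P.Adj x y → P'.Adj x y) :
    Miss A G P' := fun x hx y hy hxy hn => hP x y (h x hx y hy hxy hn)

variable [Fintype V]

@[simp] lemma dz_bot : dz (⊥ : SimpleGraph V) = 0 := by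
  funext v
  simp [dz, nb]

lemma dz_le_of_support (hS : ∀ v ∉ S, dz G v = 0) {v : V} (hv : v ∈ S) : dz G v ≤ S.card - 1 := by
  refine dz_inside_le (fun x y h => ?_) hv
  have key : ∀ x y, G.Adj x y → x ∈ S := by
    intro x y h
    by_contra hx
    have := hS x hx
    simp only [dz, Nat.cast_eq_zero, card_eq_zero, eq_empty_iff_forall_notMem, mem_nb] at this
    exact this y h
  exact ⟨key x y h, key y x h.symm⟩

lemma sum_dz_le_of_subset (hS : ∀ v ∉ S, dz G v = 0) (hAS : A ⊆ S) {J : Finset V} (hJ : J ⊆ A) :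
    ∑ a ∈ A, dz G a ≤ ∑ a ∈ J, dz G a + (A.card - J.card) * (S.card - 1) := by
  rw [← sum_sdiff hJ, add_comm]
  refine add_le_add_right ?_ _
  have h : ∑ a ∈ A \ J, dz G a ≤ ∑ a ∈ A \ J, (S.card - 1 : ℤ) :=
    sum_le_sum fun a ha => dz_le_of_support hS (hAS (mem_sdiff.1 ha).1)
  refine h.trans_eq ?_
  rw [sum_const, nsmul_eq_mul, card_sdiff_of_subset hJ, Nat.cast_sub (card_le_card hJ)]

lemma sum_compl_le (hS : ∀ v ∉ S, dz G v = 0) (hAS : A ⊆ S) {m : ℤ} (hO : ∀ o ∉ A, dz G o ≤ m) :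
    ∑ o ∈ Aᶜ, dz G o ≤ m * (S.card - A.card) := by
  have h1 : ∑ o ∈ S \ A, dz G o = ∑ o ∈ Aᶜ, dz G o := by
    refine sum_subset (fun v hv => ?_) fun v hv hv' => hS v fun h => ?_
    · exact mem_compl.2 (mem_sdiff.1 hv).2
    · exact hv' (mem_sdiff.2 ⟨h, mem_compl.1 hv⟩)
  rw [← h1]
  have h2 : ∑ o ∈ S \ A, dz G o ≤ ∑ o ∈ S \ A, m :=
    sum_le_sum fun o ho => hO o (mem_sdiff.1 ho).2
  refine h2.trans_eq ?_
  rw [sum_const, nsmul_eq_mul, card_sdiff_of_subset hAS, Nat.cast_sub (card_le_card hAS), mul_comm]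

set_option maxHeartbeats 1000000 in
lemma exists_comp_of_four {t X ν ka kb kc kd : ℤ}
    (hkey : ∀ (J : Finset V) (P : SimpleGraph V), J ⊆ A → Inside J P →
      (∀ v ∈ J, t + 3 ≤ dz G v + dz P v ∧ dz G v + dz P v ≤ ν + t + 3) →
      (∀ v ∈ A, v ∉ J → t + 3 ≤ dz G v) → ∑ v ∈ J, dz P v ≤ X →
      ∃ G', dz G' = dz G ∧ Miss A G' P)
    {a b c d : V} (haA : a ∈ A) (hbA : b ∈ A) (hcA : c ∈ A) (hdA : d ∈ A)
    (nab : a ≠ b) (nac : a ≠ c) (nad : a ≠ d) (nbc : b ≠ c) (nbd : b ≠ d) (ncd : c ≠ d)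
    (hrest : ∀ v ∈ A, v ≠ a → v ≠ b → v ≠ c → v ≠ d → t + 3 ≤ dz G v)
    (hflat : ∀ v ∈ A, dz G v ≤ ν + t + 2) (hν : dz G a ≤ t + 2 → 1 ≤ ν)
    (hac : dz G a ≤ dz G c) (hcb : dz G c ≤ dz G b) (hbd : dz G b ≤ dz G d)
    (ha : t + 1 ≤ dz G a) (hd : t + 2 ≤ dz G d) (hXe : Even X)
    (hka : t + 3 ≤ dz G a + ka) (hkb : t + 3 ≤ dz G b + kb) (hkc : t + 3 ≤ dz G c + kc)
    (hkd : t + 3 ≤ dz G d + kd) (hka0 : 0 ≤ ka) (hkd0 : 0 ≤ kd)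
    (hX1 : ka + kb + kc + kd ≤ X) (hX2 : 2 * ka ≤ X) (hX3 : 2 * (ka + kc) - 2 ≤ X) :
    ∃ G', dz G' = dz G ∧ Comp A G' := by
  obtain ⟨l, hl⟩ := hXe
  have hfa := hflat a haA
  have hfb := hflat b hbA
  have hfc := hflat c hcA
  have hfd := hflat d hdA
  have key : ∀ (P : SimpleGraph V) (pa pb pc pd : ℤ), Inside {a, b, c, d} P →
      (dz P a = pa ∧ dz P b = pb ∧ dz P c = pc ∧ dz P d = pd) →
      (t + 3 ≤ dz G a + pa ∧ dz G a + pa ≤ ν + t + 3) →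
      (t + 3 ≤ dz G b + pb ∧ dz G b + pb ≤ ν + t + 3) →
      (t + 3 ≤ dz G c + pc ∧ dz G c + pc ≤ ν + t + 3) →
      (t + 3 ≤ dz G d + pd ∧ dz G d + pd ≤ ν + t + 3) → pa + pb + pc + pd ≤ X →
      ∃ G', dz G' = dz G ∧ Miss A G' P := by
    rintro P pa pb pc pd hin ⟨rfl, rfl, rfl, rfl⟩ h1 h2 h3 h4 h5
    refine hkey {a, b, c, d} P ?_ hin ?_ ?_ ?_
    · intro v; simp only [mem_insert, mem_singleton]; grind
    · intro v; simp only [mem_insert, mem_singleton]; rintro (rfl | rfl | rfl | rfl) <;> assumption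
    · intro v hv; simp only [mem_insert, mem_singleton, not_or]
      rintro ⟨h1, h2, h3, h4⟩
      exact hrest v hv h1 h2 h3 h4
    · rw [sum_insert (by simp [nab, nac, nad]), sum_insert (by simp [nbc, nbd]),
        sum_insert (by simp [ncd]), sum_singleton]
      omega
  have paw : ∀ G', dz G' = dz G → Miss A G' (pawG a b c d) → ∃ G', dz G' = dz G ∧ Comp A G' :=
    fun G' h1 h2 => ⟨G', h1, Or.inl ⟨a, b, c, d, by simp [*], by simp [*], h2⟩⟩
  have memJ : a ∈ ({a, b, c, d} : Finset V) ∧ b ∈ ({a, b, c, d} : Finset V) ∧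
    c ∈ ({a, b, c, d} : Finset V) ∧ d ∈ ({a, b, c, d} : Finset V) := by simp
  obtain ⟨ja, jb, jc, jd⟩ := memJ
  have nba := nab.symm
  have nca := nac.symm
  have nda := nad.symm
  have ncb := nbc.symm
  have ndb := nbd.symm
  have ndc := ncd.symm
  by_cases h0 : t + 3 ≤ dz G a
  · obtain ⟨G', h1, h2⟩ := key ⊥ 0 0 0 0 inside_bot (by simp) (by omega) (by omega) (by omega)
      (by omega) (by omega)
    exact paw G' h1 (h2.mono fun x y h => h.elim)
  have hν1 := hν (by omega)
  have dab : dz (addE ⊥ a b) = dl a + dl b := by rw [dz_addE nab (by simp)]; simp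
  have dac : dz (addE ⊥ a c) = dl a + dl c := by rw [dz_addE nac (by simp)]; simp
  have dabac : dz (addE (addE ⊥ a b) a c) = dl a + dl b + dl a + dl c := by
    rw [dz_addE nac (by simp only [adj_addE]; grind [bot_adj]), dab]
  have dstar : dz (addE (addE (addE ⊥ a b) a c) a d) =
      dl a + dl b + dl a + dl c + dl a + dl d := by
    rw [dz_addE nad (by simp only [adj_addE]; grind [bot_adj]), dabac]
  have dpaw : dz (pawG a b c d) = dl a + dl b + dl a + dl c + dl a + dl d + dl b + dl c := by
    rw [pawG, dz_addE nbc (by simp only [adj_addE]; grind [bot_adj]), dstar]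
  have dtri : dz (addE (addE (addE ⊥ a b) a c) b c) =
      dl a + dl b + dl a + dl c + dl b + dl c := by
    rw [dz_addE nbc (by simp only [adj_addE]; grind [bot_adj]), dabac]
  have dpath : dz (addE (addE (addE ⊥ a b) a c) c d) =
      dl a + dl b + dl a + dl c + dl c + dl d := by
    rw [dz_addE ncd (by simp only [adj_addE]; grind [bot_adj]), dabac]
  have dmat : dz (addE (addE ⊥ a d) b c) = dl a + dl d + dl b + dl c := by
    rw [dz_addE nbc (by simp only [adj_addE]; grind [bot_adj]), dz_addE nad (by simp)]; simp
  have iab := inside_addE inside_bot ja jb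
  have iabac := inside_addE iab ja jc
  have istar := inside_addE iabac ja jd
  by_cases h1 : dz G a = t + 1
  · by_cases h2 : dz G c = t + 1
    · by_cases h3 : dz G b = t + 1
      · by_cases h4 : dz G d = t + 2
        · obtain ⟨G', h1, h2⟩ := key (pawG a b c d) 3 2 2 1 (inside_addE istar jb jc)
            (by simp [dpaw, dl, nab, nac, nad, nbc, nbd, ncd, nba, nca, nda, ncb, ndb, ndc])
            (by omega) (by omega) (by omega) (by omega) (by omega)
          exact paw G' h1 h2
        · obtain ⟨G', h1, h2⟩ := key _ 2 2 2 0 (inside_addE iabac jb jc)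
            (by simp [dtri, dl, nab, nac, nbc, nba, nca, nda, ncb, ndb, ndc])
            (by omega) (by omega) (by omega) (by omega) (by omega)
          exact paw G' h1 (h2.mono fun x y => by clear * -; simp only [pawG, adj_addE]; grind)
      · obtain ⟨G', h1, h2⟩ := key _ 2 1 2 1 (inside_addE iabac jc jd)
            (by simp [dpath, dl, nab, nac, nad, nbc, nbd, ncd, nba, nca, nda, ncb, ndb, ndc])
            (by omega) (by omega) (by omega) (by omega) (by omega)
        refine ⟨G', h1, Or.inl ⟨a, c, d, b, by simp [*], by simp [*],
          h2.mono fun x y => by clear * -; simp only [pawG, adj_addE]; grind⟩⟩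
    · by_cases h4 : dz G d = t + 2
      · obtain ⟨G', h1, h2⟩ := key _ 3 1 1 1 istar
            (by simp [dstar, dl, nab, nac, nad, nbc, nbd, ncd, nba, nca, nda, ncb, ndb, ndc])
            (by omega) (by omega) (by omega) (by omega) (by omega)
        exact paw G' h1 (h2.mono fun x y => by clear * -; simp only [pawG, adj_addE]; grind)
      · obtain ⟨G', h1, h2⟩ := key _ 2 1 1 0 iabac
            (by simp [dabac, dl, nab, nac, nbc, nba, nca, nda, ncb, ndb, ndc])
            (by omega) (by omega) (by omega) (by omega) (by omega)
        exact paw G' h1 (h2.mono fun x y => by clear * -; simp only [pawG, adj_addE]; grind)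
  · by_cases h4 : dz G d = t + 2
    · obtain ⟨G', h1, h2⟩ := key _ 1 1 1 1 (inside_addE (inside_addE inside_bot ja jd) jb jc)
            (by simp [dmat, dl, nab, nac, nad, nbc, nbd, ncd, nba, nca, nda, ncb, ndb, ndc])
            (by omega) (by omega) (by omega) (by omega) (by omega)
      exact paw G' h1 (h2.mono fun x y => by clear * -; simp only [pawG, adj_addE]; grind)
    · by_cases h3 : dz G b = t + 2
      · obtain ⟨G', h1, h2⟩ := key _ 2 1 1 0 iabac
            (by simp [dabac, dl, nab, nac, nbc, nba, nca, nda, ncb, ndb, ndc])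
            (by omega) (by omega) (by omega) (by omega) (by omega)
        exact paw G' h1 (h2.mono fun x y => by clear * -; simp only [pawG, adj_addE]; grind)
      · obtain ⟨G', h1, h2⟩ := key _ 1 0 1 0 (inside_addE inside_bot ja jc)
            (by simp [dac, dl, nac, nba, nca, nda, nbc, ndc])
            (by omega) (by omega) (by omega) (by omega) (by omega)
        exact paw G' h1 (h2.mono fun x y => by clear * -; simp only [pawG, adj_addE]; grind)

lemma exists_comp_of_five {t X ν : ℤ}
    (hkey : ∀ (J : Finset V) (P : SimpleGraph V), J ⊆ A → Inside J P →
      (∀ v ∈ J, t + 3 ≤ dz G v + dz P v ∧ dz G v + dz P v ≤ ν + t + 3) →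
      (∀ v ∈ A, v ∉ J → t + 3 ≤ dz G v) → ∑ v ∈ J, dz P v ≤ X →
      ∃ G', dz G' = dz G ∧ Miss A G' P)
    {J : Finset V} {a b c d e : V} (hJ : J = {a, b, c, d, e}) (hJA : J ⊆ A)
    (hnd : [a, b, c, d, e].Nodup) (hdeg : ∀ v ∈ J, dz G v = t + 2)
    (hrest : ∀ v ∈ A, v ∉ J → t + 3 ≤ dz G v) (hν : 1 ≤ ν) (hX : 6 ≤ X) :
    ∃ G', dz G' = dz G ∧ Comp A G' := by
  have hnd' := hnd
  simp only [List.nodup_cons, List.mem_cons, List.not_mem_nil, or_false, not_or, List.nodup_nil,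
    not_false_eq_true, and_true] at hnd
  obtain ⟨⟨nab, nac, nad, nae⟩, ⟨nbc, nbd, nbe⟩, ⟨ncd, nce⟩, nde⟩ := hnd
  have hmem : a ∈ J ∧ b ∈ J ∧ c ∈ J ∧ d ∈ J ∧ e ∈ J := by simp [hJ]
  obtain ⟨ja, jb, jc, jd, je⟩ := hmem
  have hdz : dz (pathEdgeG a b c d e) = dl a + dl b + dl b + dl c + dl d + dl e := by
    rw [pathEdgeG, dz_addE nde (by simp only [adj_addE]; grind [bot_adj]),
      dz_addE nbc (by simp only [adj_addE]; grind [bot_adj]), dz_addE nab (by simp)]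
    simp
  have hsum : ∑ v ∈ J, dz (pathEdgeG a b c d e) v = 6 := by
    simp only [hdz, Pi.add_apply, sum_add_distrib, sum_dl ja, sum_dl jb, sum_dl jc, sum_dl jd,
      sum_dl je]
    norm_num
  have hpe : ∀ v ∈ J, t + 3 ≤ dz G v + dz (pathEdgeG a b c d e) v ∧
      dz G v + dz (pathEdgeG a b c d e) v ≤ ν + t + 3 := by
    intro v hv
    rw [hdeg v hv, hdz]
    rw [hJ] at hv
    simp only [mem_insert, mem_singleton] at hv
    simp only [Pi.add_apply, dl]
    grind
  obtain ⟨G', h1, h2⟩ := hkey J (pathEdgeG a b c d e) hJA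
    (inside_addE (inside_addE (inside_addE inside_bot ja jb) jb jc) jd je) hpe hrest (by omega)
  refine ⟨G', h1, Or.inr ⟨a, b, c, d, e, hnd', fun v hv => hJA ?_, h2⟩⟩
  simpa [hJ] using hv

set_option maxHeartbeats 1000000 in
lemma flat_sparse {Q : Finset V} {t n m : ℤ} (ht : 1 ≤ t) (hn : 5 * t + 34 ≤ n)
    (hcard : (A.card : ℤ) = t + 4) (hScard : (S.card : ℤ) = n) (hAS : A ⊆ S)
    (hS : ∀ v ∉ S, dz G v = 0) (hsum : (2 * t + 1) * n + 1 ≤ ∑ v, dz G v + t * t + 2 * t)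
    (hm : m ≤ 2 * t + 4) (hO : ∀ o ∉ A, dz G o ≤ m)
    (hQ : ∀ q ∈ Q, q ∉ A ∧ dz G q = m) (hOQ : ∀ o ∉ A, o ∉ Q → dz G o ≤ m - 1)
    (hlow : ∀ a ∈ A, m ≤ dz G a) (hatt : ∃ a ∈ A, dz G a = m)
    (hflat : ∀ a ∈ A, dz G a ≤ Q.card + t + 2) :
    ∃ G', dz G' = dz G ∧ Comp A G' := by
  obtain ⟨a₀, ha₀, hma₀⟩ := hatt
  have hm0 : 0 ≤ m := hma₀ ▸ dz_nonneg G a₀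
  have hQm : m ≤ Q.card + t + 2 := hma₀ ▸ hflat a₀ ha₀
  have htot : ∑ v, dz G v = ∑ a ∈ A, dz G a + ∑ o ∈ Aᶜ, dz G o := (sum_add_sum_compl A _).symm
  have hOsum := sum_compl_le hS hAS hO
  rw [hcard, hScard] at hOsum
  have hAsum : ∑ a ∈ A, dz G a ≤ (t + 4) * (Q.card + t + 2) := by
    refine (sum_le_sum hflat).trans_eq ?_
    rw [sum_const, nsmul_eq_mul, hcard]
  have htn : t * (5 * t + 34) ≤ t * n := mul_le_mul_of_nonneg_left hn (by omega)
  have hbig : (Q.card : ℤ) ≤ m → m * (t + 4) + m * m < ∑ o ∈ Aᶜ, dz G o := by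
    intro hQle
    have h1 : (t + 4) * (Q.card + t + 2) ≤ (t + 4) * (m + t + 2) := by gcongr
    have h2 : m * m ≤ (2 * t + 4) * (2 * t + 4) := by gcongr
    have h3 : m * (t + 4) ≤ (2 * t + 4) * (t + 4) := by gcongr
    nlinarith
  have hQ1 : m ≤ t + 2 → (1 : ℤ) ≤ Q.card := by
    intro hmt
    by_contra! hQ0
    have hQ0' : (Q.card : ℤ) = 0 := by omega
    rw [hQ0'] at hAsum
    have hQe : Q = ∅ := by rw [← card_eq_zero]; exact_mod_cast hQ0'
    have h1 := sum_compl_le hS hAS (m := m - 1) (fun o ho => hOQ o ho (by simp [hQe]))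
    rw [hcard, hScard] at h1
    have h2 : (m - 1) * (n - (t + 4)) ≤ (t + 1) * (n - (t + 4)) :=
      mul_le_mul_of_nonneg_right (by omega) (by omega)
    nlinarith
  obtain ⟨a, c, b, d, e, hnd, hmem, hac, hcb, hbd, hde, hrest⟩ :=
    exists_sorted_five A (by omega) (dz G)
  simp only [List.nodup_cons, List.mem_cons, List.not_mem_nil, or_false, not_or, List.nodup_nil,
    not_false_eq_true, and_true] at hnd hrest
  obtain ⟨⟨nac, nab, nad, nae⟩, ⟨ncb, ncd, nce⟩, ⟨nbd, nbe⟩, nde⟩ := hnd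
  have haA := hmem a (by simp)
  have hbA := hmem b (by simp)
  have hcA := hmem c (by simp)
  have hdA := hmem d (by simp)
  have heA := hmem e (by simp)
  have ham : dz G a = m := by
    refine le_antisymm ?_ (hlow a haA)
    rw [← hma₀]
    by_cases h : a₀ = a ∨ a₀ = c ∨ a₀ = b ∨ a₀ = d ∨ a₀ = e
    · rcases h with rfl | rfl | rfl | rfl | rfl <;> omega
    · have := hrest a₀ ha₀ (by tauto); omega
  have hmt : t + 1 ≤ m := by
    by_contra! h
    have h1 := sum_dz_le_of_crossing G A
    rw [hcard] at h1
    have h2 : m * (n - (t + 4)) ≤ t * (n - (t + 4)) :=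
      mul_le_mul_of_nonneg_right (by omega) (by omega)
    nlinarith
  have hd2 : t + 2 ≤ dz G d := by
    by_contra! h
    have h1 := sum_dz_le_of_subset hS hAS (J := {a, c, b, d}) (by
      intro v; simp only [mem_insert, mem_singleton]; grind)
    have hJc : ((({a, c, b, d} : Finset V)).card : ℤ) = 4 := by
      rw [card_insert_of_notMem (by simp [nac, nab, nad]), card_insert_of_notMem (by simp [ncb, ncd]),
        card_insert_of_notMem (by simp [nbd]), card_singleton]
      norm_num
    rw [hJc, hcard, hScard] at h1
    simp only [sum_insert, mem_insert, mem_singleton, sum_singleton, nac, nab, nad, ncb, ncd, nbd,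
      or_self, not_false_eq_true] at h1
    have h2 : m * (n - (t + 4)) ≤ (t + 1) * (n - (t + 4)) :=
      mul_le_mul_of_nonneg_right (by omega) (by omega)
    nlinarith
  set C : SimpleGraph V := inE A ⊤ \ inE A G with hC
  have hCin : Inside A C := fun x y h => h.1.2
  have hCdz : ∀ v ∈ A, t + 3 ≤ dz G v + dz C v := fun v hv => by
    have h := congrFun (dz_compl_add (inside_inE (A := A) (G := G))) v
    have h' := congrFun (dz_out_add_in A G) v
    rw [Pi.add_apply, dz_inE_top hv, ← hC] at h
    rw [Pi.add_apply] at h'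
    have := dz_nonneg (outE A G) v
    omega
  have hkey := fun (J : Finset V) (P : SimpleGraph V) (hJ : J ⊆ A) (hP : Inside J P) =>
    realize_of_missing_on hJ hP (by omega : 0 ≤ t) hcard hO hQ hQm hbig hflat
  have hXe := even_sum_dz_inside hCin
  have hCtot : ∑ v ∈ A, dz C v = ∑ v, dz C v :=
    sum_subset (subset_univ A) fun v _ hv => dz_inside_off hCin hv
  have hCJ : ∀ J : Finset V, 2 * ∑ v ∈ J, dz C v ≤ J.card * (J.card - 1) + ∑ v ∈ A, dz C v := by
    intro J
    have h := sum_dz_le_of_crossing C J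
    rw [hCtot, ← sum_add_sum_compl J]
    linarith
  have hCsub : ∀ J ⊆ A, ∑ v ∈ J, dz C v ≤ ∑ v ∈ A, dz C v := fun J hJ =>
    sum_le_sum_of_subset_of_nonneg hJ fun v _ _ => dz_nonneg C v
  by_cases he3 : t + 3 ≤ dz G e
  · have hX2 := hCJ {a}
    have hX3 := hCJ {a, c}
    have hX1 := hCsub {a, b, c, d} (by
      intro v; simp only [mem_insert, mem_singleton]; grind)
    rw [sum_insert (by simp [nab, nac, nad]), sum_insert (by simp [Ne.symm ncb, nbd]),
      sum_insert (by simp [ncd]), sum_singleton] at hX1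
    rw [sum_pair nac, card_pair nac] at hX3
    rw [sum_singleton, card_singleton] at hX2
    push_cast at hX2 hX3
    refine exists_comp_of_four (a := a) (b := b) (c := c) (d := d) hkey haA hbA hcA hdA nab nac nad
      (Ne.symm ncb) nbd ncd ?_ hflat (by rw [ham]; exact hQ1) hac hcb hbd (by omega) hd2 hXe
      (hCdz a haA) (hCdz b hbA) (hCdz c hcA) (hCdz d hdA) (dz_nonneg C a)
      (dz_nonneg C d) (by linarith) (by linarith) (by linarith)
    intro v hv h1 h2 h3 h4
    by_cases h5 : v = e
    · rw [h5]; exact he3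
    · have := hrest v hv ⟨h1, h3, h2, h4, h5⟩; omega
  · have hJA : ({a, c, b, d, e} : Finset V) ⊆ A := by
      intro v; simp only [mem_insert, mem_singleton]; grind
    have hJc : (({a, c, b, d, e} : Finset V)).card = 5 := by
      rw [card_insert_of_notMem (by simp [nac, nab, nad, nae]),
        card_insert_of_notMem (by simp [ncb, ncd, nce]),
        card_insert_of_notMem (by simp [nbd, nbe]), card_pair nde]
    have hJs : ∀ f : V → ℤ, ∑ v ∈ ({a, c, b, d, e} : Finset V), f v = f a + f c + f b + f d + f e := by
      intro f
      rw [sum_insert (by simp [nac, nab, nad, nae]), sum_insert (by simp [ncb, ncd, nce]),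
        sum_insert (by simp [nbd, nbe]), sum_pair nde]
      ring
    have hm2 : t + 2 ≤ m := by
      by_contra! h
      have h1 := sum_dz_le_of_subset hS hAS hJA
      rw [hJc, hcard, hScard, hJs] at h1
      have h2 : m * (n - (t + 4)) ≤ (t + 1) * (n - (t + 4)) :=
        mul_le_mul_of_nonneg_right (by omega) (by omega)
      push_cast at h1
      nlinarith
    refine exists_comp_of_five (a := a) (b := c) (c := b) (d := d) (e := e) hkey rfl hJA
      (by simp; tauto) ?_ ?_ (hQ1 (by omega)) ?_
    · intro v; simp only [mem_insert, mem_singleton]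
      rintro (rfl | rfl | rfl | rfl | rfl) <;> omega
    · intro v hv hvJ
      by_contra! hv3
      have hins : insert v ({a, c, b, d, e} : Finset V) ⊆ A := insert_subset hv hJA
      have h1 := sum_dz_le_of_subset hS hAS hins
      rw [sum_insert hvJ, card_insert_of_notMem hvJ, hJc, hcard, hScard, hJs] at h1
      have h2 : m * (n - (t + 4)) ≤ (t + 2) * (n - (t + 4)) :=
        mul_le_mul_of_nonneg_right (by omega) (by omega)
      push_cast at h1
      nlinarith
    · change 6 ≤ ∑ v ∈ A, dz C v
      have h1 := hCsub _ hJA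
      rw [hJs] at h1
      have := hCdz a haA
      have := hCdz b hbA
      have := hCdz c hcA
      have := hCdz d hdA
      have := hCdz e heA
      obtain ⟨l, hl⟩ := hXe
      omega

end Sparse

section Induction
variable {V : Type*} {A S : Finset V} {G : SimpleGraph V}

lemma comp_of_clique (hA : 4 ≤ A.card) (h : ∀ x ∈ A, ∀ y ∈ A, x ≠ y → G.Adj x y) : Comp A G := by
  obtain ⟨B, hBA, hB⟩ := exists_subset_card_eq hA
  obtain ⟨p, q, r, s, h1, h2, h3, h4, h5, h6, rfl⟩ := card_eq_four.1 hB
  refine Or.inl ⟨p, q, r, s, by simp [*], fun v hv => hBA (by simpa using hv), ?_⟩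
  exact fun x hx y hy hxy hn => (hn (h x hx y hy hxy)).elim

/-- The edges of `G` at the vertex `v`. -/
def starG (v : V) (G : SimpleGraph V) : SimpleGraph V where
  Adj x y := G.Adj x y ∧ (x = v ∨ y = v)
  symm := ⟨fun _ _ h => ⟨h.1.symm, h.2.symm⟩⟩
  loopless := ⟨fun _ h => h.1.ne rfl⟩

/-- `G` with the edges at the vertex `v` removed. -/
def isolate (v : V) (G : SimpleGraph V) : SimpleGraph V where
  Adj x y := G.Adj x y ∧ x ≠ v ∧ y ≠ v
  symm := ⟨fun _ _ h => ⟨h.1.symm, h.2.2, h.2.1⟩⟩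
  loopless := ⟨fun _ h => h.1.ne rfl⟩

lemma comp_of_star {v : V} {H : SimpleGraph V} (hv : ∀ a ∈ A, a ≠ v → G.Adj v a)
    (hH : Comp (A.erase v) H) : Comp A (starG v G ⊔ H) := by
  have key : ∀ P, Miss (A.erase v) H P → Miss A (starG v G ⊔ H) P := by
    intro P hP x hx y hy hxy hn
    simp only [sup_adj, not_or, starG] at hn
    by_cases hxv : x = v
    · subst hxv; exact (hn.1 ⟨hv y hy hxy.symm, Or.inl rfl⟩).elim
    by_cases hyv : y = v
    · subst hyv; exact (hn.1 ⟨(hv x hx hxy).symm, Or.inr rfl⟩).elim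
    exact hP x (mem_erase.2 ⟨hxv, hx⟩) y (mem_erase.2 ⟨hyv, hy⟩) hxy hn.2
  rcases hH with ⟨p, q, r, s, h1, h2, h3⟩ | ⟨p, q, r, s, u, h1, h2, h3⟩
  · exact Or.inl ⟨p, q, r, s, h1, fun w hw => (mem_erase.1 (h2 w hw)).2, key _ h3⟩
  · exact Or.inr ⟨p, q, r, s, u, h1, fun w hw => (mem_erase.1 (h2 w hw)).2, key _ h3⟩

variable [Fintype V]

lemma dz_star_add_isolate (v : V) (G : SimpleGraph V) : dz G = dz (starG v G) + dz (isolate v G) := by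
  rw [← dz_sup]
  · congr 1
    ext x y
    simp only [sup_adj, starG, isolate]
    tauto
  · intro x y h h'
    simp only [starG, isolate] at h h'
    tauto

lemma dz_isolate_self (v : V) (G : SimpleGraph V) : dz (isolate v G) v = 0 := by
  simp [dz, nb, isolate]

lemma dz_star_of_adj {v w : V} (h : G.Adj v w) : dz (starG v G) w = 1 := by
  have : nb (starG v G) w = {v} := by
    ext x
    simp only [mem_nb, starG, mem_singleton]
    refine ⟨fun hx => hx.2.resolve_left h.ne', ?_⟩
    rintro rfl
    exact ⟨h.symm, Or.inr rfl⟩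
  simp [dz, this]

lemma dz_star_le {v w : V} (h : w ≠ v) : dz (starG v G) w ≤ 1 := by
  have : nb (starG v G) w ⊆ {v} := by
    intro x hx
    simp only [mem_nb, starG] at hx
    simpa using hx.2.resolve_left h
  have := card_le_card this
  rw [card_singleton] at this
  simp only [dz]
  exact_mod_cast this

lemma exists_comp_base (hcard : A.card = 4) (hS : ∀ v ∉ S, dz G v = 0)
    (htop : ∀ a ∈ A, ∀ o ∉ A, dz G o ≤ dz G a) (hsum : (S.card : ℤ) + 1 ≤ ∑ v, dz G v) :
    ∃ G', dz G' = dz G ∧ Comp A G' := by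
  have hne : A.Nonempty := card_pos.1 (by omega)
  obtain ⟨v, hvA, hv⟩ := exists_max_image A (dz G) hne
  have h3 : (A.erase v).card = 3 := by rw [card_erase_of_mem hvA, hcard]
  obtain ⟨w, hw, hwmin⟩ := exists_min_image (A.erase v) (dz G) (card_pos.1 (by omega))
  obtain ⟨x, y, hxy, hK⟩ := card_eq_two.1
    (show ((A.erase v).erase w).card = 2 by rw [card_erase_of_mem hw, h3])
  have hmem : ∀ z, z ∈ A ↔ z = v ∨ z = w ∨ z = x ∨ z = y := by
    intro z
    have h : z ∈ (A.erase v).erase w ↔ z ∈ ({x, y} : Finset V) := by rw [hK]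
    simp only [mem_erase, mem_insert, mem_singleton] at h hw
    grind
  have hx : x ∈ (A.erase v).erase w := by simp [hK]
  have hy : y ∈ (A.erase v).erase w := by simp [hK]
  simp only [mem_erase] at hx hy hw
  have h2 : 2 ≤ dz G v := by
    by_contra! hlt
    have h1 : ∑ u ∈ S, dz G u ≤ ∑ u ∈ S, (1 : ℤ) := by
      refine sum_le_sum fun u _ => ?_
      by_cases hu : u ∈ A
      · have := hv u hu; omega
      · have := htop v hvA u hu; omega
    rw [sum_subset (subset_univ S) fun u _ hu => hS u hu] at h1
    simp at h1
    omega
  obtain ⟨G', hd, hadj⟩ := exists_joined G v {x, y} (by simp; tauto)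
    (by rw [card_pair hxy]; exact_mod_cast h2) (by
      intro k hk o ho hov
      rw [← hK] at hk ho
      by_cases hoA : o ∈ A
      · have how : o = w := by
          by_contra h
          exact ho (mem_erase.2 ⟨h, mem_erase.2 ⟨hov, hoA⟩⟩)
        rw [how]
        exact hwmin k (mem_erase.1 hk).2
      · exact htop k (mem_erase.1 (mem_erase.1 hk).2).2 o hoA)
  refine ⟨G', hd, Or.inl ⟨w, x, y, v, ?_, ?_, ?_⟩⟩
  · simp only [List.nodup_cons, List.mem_cons, List.not_mem_nil, or_false, not_or]
    grind
  · simp only [List.mem_cons, List.not_mem_nil, or_false]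
    grind
  · intro a ha b hb hab hn
    have hvx := hadj x (by simp)
    have hvy := hadj y (by simp)
    have hn' : ¬ G'.Adj b a := fun h => hn h.symm
    rw [hmem] at ha hb
    simp only [pawG, adj_addE]
    rcases ha with rfl | rfl | rfl | rfl <;> rcases hb with rfl | rfl | rfl | rfl <;>
      first | exact absurd rfl hab | (exfalso; tauto) | grind

theorem exists_comp (t : ℕ) : ∀ (A S : Finset V) (G : SimpleGraph V), A.card = t + 4 → A ⊆ S →
    (∀ v ∉ S, dz G v = 0) → (∀ a ∈ A, ∀ o ∉ A, dz G o ≤ dz G a) → 5 * t + 34 ≤ S.card →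
    (2 * (t : ℤ) + 1) * S.card + 1 ≤ ∑ v, dz G v + t * t + 2 * t →
    ∃ G', dz G' = dz G ∧ Comp A G' := by
  induction t with
  | zero =>
    intro A S G hcard hAS hS htop _ hsum
    exact exists_comp_base hcard hS htop (by push_cast at hsum; linarith)
  | succ t ih =>
    intro A S G hcard hAS hS htop hn hsum
    obtain ⟨a₀, ha₀, hmin⟩ := exists_min_image A (dz G) (card_pos.1 (by omega))
    set Q : Finset V := univ.filter fun o => o ∉ A ∧ dz G o = dz G a₀ with hQdef
    have hQ : ∀ q ∈ Q, q ∉ A ∧ dz G q = dz G a₀ := fun q hq => (mem_filter.1 hq).2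
    have hOQ : ∀ o ∉ A, o ∉ Q → dz G o ≤ dz G a₀ - 1 := by
      intro o ho hoQ
      have h1 := htop a₀ ha₀ o ho
      have h2 : dz G o ≠ dz G a₀ := fun h => hoQ (by simp [hQdef, ho, h])
      omega
    have hcard' : (A.card : ℤ) = ((t + 1 : ℕ) : ℤ) + 4 := by rw [hcard]; push_cast; ring
    by_cases hflat : ∀ a ∈ A, dz G a ≤ Q.card + ((t + 1 : ℕ) : ℤ) + 2
    · by_cases hm : dz G a₀ ≤ 2 * ((t + 1 : ℕ) : ℤ) + 4
      · exact flat_sparse (by omega) (by exact_mod_cast hn) hcard' rfl hAS hS hsum hm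
          (fun o ho => htop a₀ ha₀ o ho) hQ hOQ hmin ⟨a₀, ha₀, rfl⟩ hflat
      · obtain ⟨G', hd, h⟩ := flat_dense (by omega) hcard' (by omega) hQ hOQ hmin hflat
        exact ⟨G', hd, comp_of_clique (by omega) h⟩
    · push Not at hflat
      obtain ⟨v, hvA, hv⟩ := hflat
      have hvS := hAS hvA
      have hvQ : v ∉ Q := fun h => (hQ v h).1 hvA
      obtain ⟨G₁, hd₁, hadj⟩ := exists_joined G v (A.erase v ∪ Q) (by simp [hvQ]) (by
          rw [card_union_of_disjoint]
          · rw [card_erase_of_mem hvA, hcard]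
            push_cast at hv ⊢
            omega
          · rw [Finset.disjoint_left]
            exact fun x hx hxQ => (hQ x hxQ).1 (mem_erase.1 hx).2) (by
          intro k hk o ho hov
          simp only [mem_union, mem_erase, not_or, not_and] at hk ho
          have hoA : o ∉ A := ho.1 hov
          rcases hk with hk | hk
          · exact htop k hk.2 o hoA
          · rw [(hQ k hk).2]
            exact htop a₀ ha₀ o hoA)
      have hsplit := dz_star_add_isolate v G₁
      have hsplit' : ∀ w, dz G w = dz (starG v G₁) w + dz (isolate v G₁) w := fun w => by
        rw [← hd₁]; exact congrFun hsplit w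
      have hstar0 : ∀ w, 0 ≤ dz (starG v G₁) w := dz_nonneg _
      obtain ⟨H, hH, hHc⟩ := ih (A.erase v) (S.erase v) (isolate v G₁)
        (by rw [card_erase_of_mem hvA, hcard]; omega) (erase_subset_erase v hAS)
        (by
          intro w hw
          by_cases hwv : w = v
          · rw [hwv, dz_isolate_self]
          · have := hS w fun h => hw (mem_erase.2 ⟨hwv, h⟩)
            have := hsplit' w
            have := hstar0 w
            have := dz_nonneg (isolate v G₁) w
            omega)
        (by
          intro a ha o ho
          have ha1 := mem_erase.1 ha
          have hsa := dz_star_of_adj (hadj a (mem_union_left _ ha))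
          have h1 := hsplit' a
          by_cases hov : o = v
          · rw [hov, dz_isolate_self]; exact dz_nonneg _ _
          have hoA : o ∉ A := fun h => ho (mem_erase.2 ⟨hov, h⟩)
          have h2 := hsplit' o
          have h3 := hstar0 o
          have h4 := htop a ha1.2 o hoA
          have h5 := hmin a ha1.2
          by_cases hoQ : o ∈ Q
          · have := dz_star_of_adj (hadj o (mem_union_right _ hoQ))
            omega
          · have := hOQ o hoA hoQ
            omega)
        (by rw [card_erase_of_mem hvS]; omega)
        (by
          rw [card_erase_of_mem hvS, Nat.cast_sub (by omega)]
          have htot : ∑ w, dz G w = ∑ w, dz (starG v G₁) w + ∑ w, dz (isolate v G₁) w := by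
            rw [← sum_add_distrib]; exact sum_congr rfl fun w _ => hsplit' w
          have hvd : dz (starG v G₁) v ≤ S.card - 1 := by
            have h1 := dz_le_of_support hS hvS
            have h2 := hsplit' v
            rw [dz_isolate_self] at h2
            omega
          have hstarS : ∑ w, dz (starG v G₁) w = ∑ w ∈ S, dz (starG v G₁) w := by
            refine (sum_subset (subset_univ S) fun w _ hw => ?_).symm
            have := hS w hw
            have := hsplit' w
            have := hstar0 w
            have := dz_nonneg (isolate v G₁) w
            omega
          have hstar : ∑ w ∈ S.erase v, dz (starG v G₁) w ≤ ∑ w ∈ S.erase v, (1 : ℤ) :=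
            sum_le_sum fun w hw => dz_star_le (mem_erase.1 hw).1
          rw [sum_const, card_erase_of_mem hvS, nsmul_eq_mul, Nat.cast_sub (by omega)] at hstar
          rw [← add_sum_erase S _ hvS] at hstarS
          push_cast at hsum hstar ⊢
          linarith)
      refine ⟨starG v G₁ ⊔ H, ?_, comp_of_star (fun a ha hav => hadj a (by simp [ha, hav])) hHc⟩
      rw [dz_sup, hH, ← hsplit, hd₁]
      intro x y h h'
      have hHv : dz H v = 0 := by rw [hH, dz_isolate_self]
      simp only [dz, Nat.cast_eq_zero, card_eq_zero, eq_empty_iff_forall_notMem, mem_nb] at hHv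
      rcases h.2 with rfl | rfl
      · exact hHv _ h'
      · exact hHv _ h'.symm

end Induction

section Forbidden
variable {k : ℕ} {Z : SimpleGraph (Fin k)}

lemma containsCopy_C4 {w x y z : Fin k} (h : [w, x, y, z].Nodup) (hwx : Z.Adj w x)
    (hxy : Z.Adj x y) (hyz : Z.Adj y z) (hzw : Z.Adj z w) : ContainsCopy Z C4 := by
  refine ⟨⟨[w, x, y, z].get, List.nodup_iff_injective_get.1 h⟩, ?_⟩
  have := hwx.symm
  have := hxy.symm
  have := hyz.symm
  have := hzw.symm
  intro u v huv
  rw [C4, fromEdgeSet_adj] at huv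
  fin_cases u <;> fin_cases v <;> simp_all

lemma exists_paw (h : ContainsCopy Z Z4) : ∃ a b c d : Fin k, [a, b, c, d].Nodup ∧ Z.Adj a b ∧
    Z.Adj a c ∧ Z.Adj a d ∧ Z.Adj b c := by
  obtain ⟨f, hf⟩ := h
  refine ⟨f 3, f 0, f 2, f 1, by simp, hf _ _ ?_, hf _ _ ?_, hf _ _ ?_, hf _ _ ?_⟩ <;>
    simp [Z4]

lemma exists_pathEdge {a b c d : Fin k} (hnd : [a, b, c, d].Nodup) (hab : Z.Adj a b)
    (hac : Z.Adj a c) (had : Z.Adj a d) (hbc : Z.Adj b c) (hC4 : ¬ ContainsCopy Z C4)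
    (hcard : 5 ≤ Z.edgeSet.ncard) : ∃ p q r s u : Fin k, [p, q, r, s, u].Nodup ∧ Z.Adj p q ∧
      Z.Adj q r ∧ Z.Adj s u := by
  obtain ⟨e, he, heT⟩ : ∃ e ∈ Z.edgeSet, e ∉ ({s(a, b), s(a, c), s(a, d), s(b, c)} : Finset _) := by
    by_contra! h
    have h1 := Set.ncard_le_ncard (t := (({s(a, b), s(a, c), s(a, d), s(b, c)} :
      Finset (Sym2 (Fin k))) : Set (Sym2 (Fin k)))) h (Finset.finite_toSet _)
    rw [Set.ncard_coe_finset] at h1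
    have := card_le_four (a := s(a, b)) (b := s(a, c)) (c := s(a, d)) (d := s(b, c))
    omega
  have hout : ∀ x y, Z.Adj x y → y ∉ [a, b, c, d] → ∃ p q r s u : Fin k,
      [p, q, r, s, u].Nodup ∧ Z.Adj p q ∧ Z.Adj q r ∧ Z.Adj s u := by
    intro x y hxy hy
    have hne := hxy.ne
    simp only [List.nodup_cons, List.mem_cons, List.not_mem_nil, or_false, not_or, List.nodup_nil,
      not_false_eq_true, and_true] at hnd hy ⊢
    by_cases h1 : x = a
    · subst h1; exact ⟨d, x, y, b, c, by grind, had.symm, hxy, hbc⟩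
    by_cases h2 : x = b
    · subst h2; exact ⟨y, x, c, a, d, by grind, hxy.symm, hbc, had⟩
    by_cases h3 : x = c
    · subst h3; exact ⟨y, x, b, a, d, by grind, hxy.symm, hbc.symm, had⟩
    by_cases h4 : x = d
    · subst h4; exact ⟨a, x, y, b, c, by grind, had, hxy, hbc⟩
    exact ⟨a, b, c, x, y, by grind, hab, hbc, hxy⟩
  induction e with | _ x y
  rw [mem_edgeSet] at he
  by_cases hy : y ∈ [a, b, c, d]
  · by_cases hx : x ∈ [a, b, c, d]
    · exfalso
      have hne := he.ne
      have h1 : ¬ Z.Adj b d := fun h => hC4 (containsCopy_C4 (w := b) (x := d) (y := a) (z := c)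
        (by simp at hnd ⊢; grind) h had.symm hac hbc.symm)
      have h2 : ¬ Z.Adj c d := fun h => hC4 (containsCopy_C4 (w := c) (x := d) (y := a) (z := b)
        (by simp at hnd ⊢; grind) h had.symm hab hbc)
      have h1' : ¬ Z.Adj d b := fun h => h1 h.symm
      have h2' : ¬ Z.Adj d c := fun h => h2 h.symm
      simp only [List.mem_cons, List.not_mem_nil, or_false] at hx hy
      rcases hx with rfl | rfl | rfl | rfl <;> rcases hy with rfl | rfl | rfl | rfl <;>
        simp_all
    · exact hout y x he.symm hx
  · exact hout x y he hy

end Forbidden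

section Upper
variable {V : Type*} {A : Finset V} {G P : SimpleGraph V}

lemma exists_embedding_of_miss {m l : ℕ} {B : SimpleGraph (Fin m)} (hcard : A.card = m)
    (x : Fin l ↪ Fin m) (y : Fin l ↪ V) (hy : ∀ i, y i ∈ A) (hmiss : Miss A G P)
    (hP : ∀ u v, P.Adj u v → ∃ i j, u = y i ∧ v = y j ∧ B.Adj (x i) (x j)) :
    ∃ f : Fin m ↪ V, ∀ u v, u ≠ v → ¬ B.Adj u v → G.Adj (f u) (f v) := by
  obtain ⟨g, hg⟩ := (Equiv.Perm.isMultiplyPretransitive A l).exists_smul_eq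
    (x.trans (finCongr hcard.symm |>.trans A.equivFin.symm).toEmbedding)
    ⟨fun i => ⟨y i, hy i⟩, fun i j h => y.injective (Subtype.ext_iff.1 h)⟩
  set e := (finCongr hcard.symm |>.trans A.equivFin.symm).trans g with he
  have hxy : ∀ i, (e (x i) : V) = y i := fun i => by
    have := DFunLike.congr_fun hg i
    exact congrArg Subtype.val this
  refine ⟨e.toEmbedding.trans (Function.Embedding.subtype _), fun u v huv hB => ?_⟩
  change G.Adj (e u) (e v)
  by_contra hn
  obtain ⟨i, j, hi, hj, hij⟩ := hP _ _ (hmiss _ (e u).2 _ (e v).2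
    (fun h => huv (e.injective (Subtype.ext h))) hn)
  rw [← hxy, Subtype.coe_inj, e.apply_eq_iff_eq] at hi hj
  exact hB (hi ▸ hj ▸ hij)

lemma containsCopy_of_comp {m k : ℕ} (hkm : k ≤ m) {Z : SimpleGraph (Fin k)} (hA : A.card = m)
    (hZ4 : ContainsCopy Z Z4) (hC4 : ¬ ContainsCopy Z C4) (hcard : 5 ≤ Z.edgeSet.ncard)
    (hG : Comp A G) : ContainsCopy G (KsubH m k hkm Z) := by
  obtain ⟨a, b, c, d, hnd, hab, hac, had, hbc⟩ := exists_paw hZ4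
  suffices h : ∃ f : Fin m ↪ V, ∀ u v, u ≠ v → ¬ (Z.map (Fin.castLEEmb hkm)).Adj u v →
      G.Adj (f u) (f v) by
    obtain ⟨f, hf⟩ := h
    exact ⟨f, fun u v huv => hf u v huv.1 huv.2⟩
  rcases hG with ⟨p, q, r, s, hn, hmem, hmiss⟩ | ⟨p, q, r, s, u, hn, hmem, hmiss⟩
  · refine exists_embedding_of_miss hA (l := 4)
      (Function.Embedding.trans ⟨[a, b, c, d].get, List.nodup_iff_injective_get.1 hnd⟩
        (Fin.castLEEmb hkm))
      ⟨[p, q, r, s].get, List.nodup_iff_injective_get.1 hn⟩ (fun i => hmem _ (List.get_mem [p, q, r, s] i))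
      hmiss ?_
    simp only [Function.Embedding.trans_apply, map_adj_apply]
    intro x y hxy
    simp only [pawG, adj_addE, bot_adj, false_or] at hxy
    rcases hxy with (((h | h) | h) | h) <;> rcases h with ⟨-, ⟨rfl, rfl⟩ | ⟨rfl, rfl⟩⟩
    · exact ⟨0, 1, rfl, rfl, hab⟩
    · exact ⟨1, 0, rfl, rfl, hab.symm⟩
    · exact ⟨0, 2, rfl, rfl, hac⟩
    · exact ⟨2, 0, rfl, rfl, hac.symm⟩
    · exact ⟨0, 3, rfl, rfl, had⟩
    · exact ⟨3, 0, rfl, rfl, had.symm⟩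
    · exact ⟨1, 2, rfl, rfl, hbc⟩
    · exact ⟨2, 1, rfl, rfl, hbc.symm⟩
  · obtain ⟨p', q', r', s', u', hnd', hpq, hqr, hsu⟩ :=
      exists_pathEdge hnd hab hac had hbc hC4 hcard
    refine exists_embedding_of_miss hA (l := 5)
      (Function.Embedding.trans ⟨[p', q', r', s', u'].get, List.nodup_iff_injective_get.1 hnd'⟩
        (Fin.castLEEmb hkm))
      ⟨[p, q, r, s, u].get, List.nodup_iff_injective_get.1 hn⟩
      (fun i => hmem _ (List.get_mem [p, q, r, s, u] i)) hmiss ?_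
    simp only [Function.Embedding.trans_apply, map_adj_apply]
    intro x y hxy
    simp only [pathEdgeG, adj_addE, bot_adj, false_or] at hxy
    rcases hxy with ((h | h) | h) <;> rcases h with ⟨-, ⟨rfl, rfl⟩ | ⟨rfl, rfl⟩⟩
    · exact ⟨0, 1, rfl, rfl, hpq⟩
    · exact ⟨1, 0, rfl, rfl, hpq.symm⟩
    · exact ⟨1, 2, rfl, rfl, hqr⟩
    · exact ⟨2, 1, rfl, rfl, hqr.symm⟩
    · exact ⟨3, 4, rfl, rfl, hsu⟩
    · exact ⟨4, 3, rfl, rfl, hsu.symm⟩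

lemma dz_eq_of_isRealization {n : ℕ} {G : SimpleGraph (Fin n)} {d : Fin n → ℕ}
    (h : IsRealization G d) (i : Fin n) : dz G i = d i := by
  rw [dz, nb_card_degree, h i]

theorem potentiallyGraphic_of_le_sum {t k n : ℕ} (hkt : k ≤ t + 4) (hn : 5 * t + 34 ≤ n)
    {Z : SimpleGraph (Fin k)} (hZ4 : ContainsCopy Z Z4) (hC4 : ¬ ContainsCopy Z C4)
    (hcard : 5 ≤ Z.edgeSet.ncard) {d : Fin n → ℕ} (hd : IsGraphic d)
    (hsum : (2 * (t : ℤ) + 1) * n + 1 ≤ ((∑ i, d i : ℕ) : ℤ) + t * t + 2 * t) :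
    PotentiallyGraphic d (KsubH (t + 4) k hkt Z) := by
  obtain ⟨hanti, G, hG⟩ := hd
  have hdz := dz_eq_of_isRealization hG
  have hAcard : (univ.filter fun i : Fin n => (i : ℕ) < t + 4).card = t + 4 := by
    rw [Fin.card_filter_val_lt]; omega
  obtain ⟨G', hd', hcomp⟩ := exists_comp t (univ.filter fun i : Fin n => (i : ℕ) < t + 4) univ G
    hAcard (subset_univ _) (fun v hv => (hv (mem_univ v)).elim)
    (by
      intro a ha o ho
      simp only [mem_filter, mem_univ, true_and, not_lt] at ha ho
      rw [hdz, hdz, Nat.cast_le]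
      exact hanti (Fin.le_def.2 (by omega)))
    (by simpa using hn) (by simpa [hdz] using hsum)
  refine ⟨G', fun i => ?_, containsCopy_of_comp hkt hAcard hZ4 hC4 hcard hcomp⟩
  have h := congrFun hd' i
  rw [hdz, dz, nb_card_degree, Nat.cast_inj] at h
  exact h

end Upper

/-- The join of a complete graph on `t` vertices with a maximum matching on the remaining
vertices. -/
def joinMatching (t n : ℕ) : SimpleGraph (Fin n) where
  Adj i j := i ≠ j ∧ ((i : ℕ) < t ∨ (j : ℕ) < t ∨ ((i : ℕ) - t) / 2 = ((j : ℕ) - t) / 2)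
  symm := ⟨fun _ _ h => ⟨h.1.symm, by omega⟩⟩
  loopless := ⟨fun _ h => h.1 rfl⟩

/-- The degree sequence of `joinMatching t n`. -/
def joinMatchingDeg (t n : ℕ) (i : Fin n) : ℕ :=
  if (i : ℕ) < t then n - 1 else if (i : ℕ) + 1 = n ∧ (n - t) % 2 = 1 then t else t + 1

section Lower
variable {t n : ℕ}

lemma isRealization_joinMatching (ht : t ≤ n) :
    IsRealization (joinMatching t n) (joinMatchingDeg t n) := by
  intro i
  rw [← nb_card_degree, joinMatchingDeg]
  have hlow : (univ.filter fun j : Fin n => (j : ℕ) < t).card = t := by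
    rw [Fin.card_filter_val_lt]; omega
  split_ifs with h1 h2
  · have : nb (joinMatching t n) i = univ.erase i := by
      ext j
      simp only [mem_nb, joinMatching, mem_erase, mem_univ, and_true]
      grind
    rw [this, card_erase_of_mem (mem_univ i), card_univ, Fintype.card_fin]
  · have : nb (joinMatching t n) i = univ.filter fun j : Fin n => (j : ℕ) < t := by
      ext j
      simp only [mem_nb, joinMatching, mem_filter, mem_univ, true_and, ne_eq, Fin.ext_iff]
      have := j.2
      omega
    rw [this, hlow]
  · obtain ⟨p, hp1, hp2, hp3⟩ : ∃ p : Fin n, t ≤ (p : ℕ) ∧ p ≠ i ∧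
        ((p : ℕ) - t) / 2 = ((i : ℕ) - t) / 2 := by
      have := i.2
      by_cases hpar : ((i : ℕ) - t) % 2 = 0
      · exact ⟨⟨i + 1, by omega⟩, by simp; omega, by simp [Fin.ext_iff], by simp; omega⟩
      · exact ⟨⟨i - 1, by omega⟩, by simp; omega, by simp [Fin.ext_iff]; omega, by simp; omega⟩
    have : nb (joinMatching t n) i = insert p (univ.filter fun j : Fin n => (j : ℕ) < t) := by
      ext j
      simp only [mem_nb, joinMatching, mem_insert, mem_filter, mem_univ, true_and, ne_eq,
        Fin.ext_iff] at hp2 ⊢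
      have := j.2
      omega
    rw [this, card_insert_of_notMem (by simp; omega), hlow]

lemma antitone_joinMatchingDeg (ht : t + 2 ≤ n) : Antitone (joinMatchingDeg t n) := by
  intro i j hij
  rw [Fin.le_def] at hij
  have := j.2
  simp only [joinMatchingDeg]
  split_ifs <;> omega

lemma sum_joinMatchingDeg (ht : t + 2 ≤ n) : ((∑ i, joinMatchingDeg t n i : ℕ) : ℤ) =
    (2 * t + 1) * n - t * t - 2 * t - if (n - t) % 2 = 1 then 1 else 0 := by
  have hdeg : ∀ i : Fin n, (joinMatchingDeg t n i : ℤ) = (t + 1) +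
      (if (i : ℕ) < t then (n - t - 2 : ℤ) else 0) -
      (if i = ⟨n - 1, by omega⟩ then if (n - t) % 2 = 1 then 1 else 0 else 0) := by
    intro i
    have := i.2
    simp only [joinMatchingDeg, Fin.ext_iff]
    split_ifs <;> push_cast <;> omega
  rw [Nat.cast_sum, sum_congr rfl fun i _ => hdeg i, sum_sub_distrib, sum_add_distrib,
    ← sum_filter, sum_const, sum_const, Fin.card_filter_val_lt, sum_ite_eq' univ]
  simp only [mem_univ, if_true, card_univ, Fintype.card_fin, nsmul_eq_mul,
    min_eq_right (show t ≤ n by omega)]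
  ring

lemma exists_cycle_of_matching {V : Type*} {B : SimpleGraph V} {a b c d : V}
    (hnd : [a, b, c, d].Nodup)
    (h : ∀ x ∈ [a, b, c, d], ∀ y ∈ [a, b, c, d], ∀ z ∈ [a, b, c, d], [x, y, z].Nodup →
      B.Adj x y ∨ B.Adj x z) :
    ∃ w x y z, [w, x, y, z].Nodup ∧ B.Adj w x ∧ B.Adj x y ∧ B.Adj y z ∧ B.Adj z w := by
  simp only [List.nodup_cons, List.mem_cons, List.not_mem_nil, or_false, not_or, List.nodup_nil,
    not_false_eq_true, and_true, forall_eq_or_imp, forall_eq] at hnd h ⊢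
  have hs : ∀ x y, B.Adj x y → B.Adj y x := fun x y h => h.symm
  by_cases hac : B.Adj a c
  · by_cases hab : B.Adj a b
    · by_cases had : B.Adj a d
      · by_cases hbc : B.Adj b c
        · by_cases hcd : B.Adj c d
          · exact ⟨a, b, c, d, by grind⟩
          · exact ⟨a, c, b, d, by grind⟩
        · exact ⟨a, b, d, c, by grind⟩
      · exact ⟨a, b, d, c, by grind⟩
    · exact ⟨a, c, b, d, by grind⟩
  · exact ⟨a, b, c, d, by grind⟩

lemma adj_of_joinMatchingDeg {G : SimpleGraph (Fin n)} (hG : IsRealization G (joinMatchingDeg t n))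
    {i j : Fin n} (hi : (i : ℕ) < t) (hij : j ≠ i) : G.Adj i j := by
  have h1 := hG i
  rw [← nb_card_degree, joinMatchingDeg, if_pos hi] at h1
  have h2 : nb G i = univ.erase i := by
    refine eq_of_subset_of_card_le (fun x hx => ?_) ?_
    · exact mem_erase.2 ⟨(mem_nb.1 hx).ne', mem_univ x⟩
    · rw [h1, card_erase_of_mem (mem_univ i), card_univ, Fintype.card_fin]
  exact mem_nb.1 (h2 ▸ mem_erase.2 ⟨hij, mem_univ j⟩)

lemma eq_of_adj_of_joinMatchingDeg (ht : t ≤ n) {G : SimpleGraph (Fin n)}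
    (hG : IsRealization G (joinMatchingDeg t n)) {i x y : Fin n} (hi : t ≤ (i : ℕ))
    (hx : t ≤ (x : ℕ)) (hy : t ≤ (y : ℕ)) (hix : G.Adj i x) (hiy : G.Adj i y) : x = y := by
  by_contra hxy
  have hsub : insert x (insert y (univ.filter fun j : Fin n => (j : ℕ) < t)) ⊆ nb G i := by
    intro j hj
    simp only [mem_insert, mem_filter, mem_univ, true_and] at hj
    rw [mem_nb]
    rcases hj with rfl | rfl | hj
    · exact hix
    · exact hiy
    · exact (adj_of_joinMatchingDeg hG hj (by rintro rfl; omega)).symm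
  have h1 := card_le_card hsub
  rw [card_insert_of_notMem (by simp [hxy, hx]), card_insert_of_notMem (by simp [hy]),
    Fin.card_filter_val_lt, nb_card_degree, hG i, joinMatchingDeg, if_neg (by omega)] at h1
  split_ifs at h1 <;> omega

theorem not_potentiallyGraphic_joinMatchingDeg {k : ℕ} (ht : t ≤ n) (hkt : k ≤ t + 4)
    {Z : SimpleGraph (Fin k)} (hC4 : ¬ ContainsCopy Z C4) :
    ¬ PotentiallyGraphic (joinMatchingDeg t n) (KsubH (t + 4) k hkt Z) := by
  rintro ⟨G, hG, f, hf⟩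
  have hlow : (univ.filter fun u => (f u : ℕ) < t).card ≤ t := by
    rw [← card_map f]
    refine (card_le_card (t := univ.filter fun j : Fin n => (j : ℕ) < t) ?_).trans ?_
    · intro j
      simp only [mem_map, mem_filter, mem_univ, true_and]
      rintro ⟨u, hu, rfl⟩
      exact hu
    · rw [Fin.card_filter_val_lt]
      omega
  have hhigh : 4 ≤ (univ.filter fun u => ¬ (f u : ℕ) < t).card := by
    have := card_filter_add_card_filter_not (s := univ) (fun u => (f u : ℕ) < t)
    rw [card_univ, Fintype.card_fin] at this
    omega
  obtain ⟨U, hU, hUcard⟩ := exists_subset_card_eq hhigh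
  obtain ⟨a, b, c, d, hab, hac, had, hbc, hbd, hcd, rfl⟩ := card_eq_four.1 hUcard
  have hUt : ∀ u ∈ [a, b, c, d], t ≤ (f u : ℕ) := fun u hu => by
    simpa using hU (show u ∈ ({a, b, c, d} : Finset _) by simpa using hu)
  obtain ⟨w, x, y, z, hnd, hwx, hxy, hyz, hzw⟩ := exists_cycle_of_matching
    (B := Z.map (Fin.castLEEmb hkt)) (a := a) (b := b) (c := c) (d := d) (by simp [*]) (by
      intro x hx y hy z hz hnd
      simp only [List.nodup_cons, List.mem_cons, List.not_mem_nil, or_false, not_or] at hnd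
      by_contra! hcon
      exact hnd.2.1 (f.injective (eq_of_adj_of_joinMatchingDeg ht hG (hUt x hx) (hUt y hy)
        (hUt z hz) (hf _ _ ⟨hnd.1.1, hcon.1⟩) (hf _ _ ⟨hnd.1.2, hcon.2⟩))))
  have hpre : ∀ u v, (Z.map (Fin.castLEEmb hkt)).Adj u v → ∃ u', u = Fin.castLEEmb hkt u' := by
    rintro u v ⟨-, u', v', -, h, -⟩
    exact ⟨u', h.symm⟩
  obtain ⟨w', hw⟩ := hpre w x hwx
  obtain ⟨x', hx⟩ := hpre x y hxy
  obtain ⟨y', hy⟩ := hpre y z hyz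
  obtain ⟨z', hz⟩ := hpre z w hzw
  subst hw hx hy hz
  rw [map_adj_apply] at hwx hxy hyz hzw
  refine hC4 (containsCopy_C4 (w := w') (x := x') (y := y') (z := z') ?_ hwx hxy hyz hzw)
  refine List.Nodup.of_map (Fin.castLEEmb hkt) ?_
  simpa using hnd

end Lower

/-- Theorem 1.2: for `n ≥ 5r + 19`, `r + 1 ≥ k ≥ 5`, `j ≥ 5`, and `Z` a graph on `k`
vertices and `j` edges which contains `Z₄` but contains no cycle on 4 vertices,
`σ(K_{r+1} - Z, n)` equals `(r-1)(2n-r) - 3(n-r) - 1` if `n - r` is odd, and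
`(r-1)(2n-r) - 3(n-r) - 2` if `n - r` is even. -/
theorem stmt2 (r k j n : ℕ) (hn : 5 * r + 19 ≤ n) (hk5 : 5 ≤ k) (hkr : k ≤ r + 1)
    (hj : 5 ≤ j) (Z : SimpleGraph (Fin k)) (hedges : Z.edgeSet.ncard = j)
    (hZ4 : ContainsCopy Z Z4) (hC4 : ¬ ContainsCopy Z C4) :
    ∃ m : ℕ, IsLeast (SigmaSet (KsubH (r + 1) k hkr Z) n) m ∧
      (m : ℤ) = if Odd (n - r)
        then ((r : ℤ) - 1) * (2 * (n : ℤ) - r) - 3 * ((n : ℤ) - r) - 1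
        else ((r : ℤ) - 1) * (2 * (n : ℤ) - r) - 3 * ((n : ℤ) - r) - 2 := by
  obtain ⟨t, rfl⟩ : ∃ t, r = t + 3 := ⟨r - 3, by omega⟩
  have hreal := isRealization_joinMatching (t := t) (n := n) (by omega)
  have hsum := sum_joinMatchingDeg (t := t) (n := n) (by omega)
  have heven : Even (∑ i, joinMatchingDeg t n i) := by
    have h := even_sum_dz (joinMatching t n)
    simp only [dz_eq_of_isRealization hreal] at h
    exact_mod_cast h
  refine ⟨∑ i, joinMatchingDeg t n i + 2, ⟨⟨heven.add even_two, fun d hd hle => ?_⟩, ?_⟩, ?_⟩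
  · refine potentiallyGraphic_of_le_sum hkr (by omega) hZ4 hC4 (by omega) hd ?_
    have hle' : ((∑ i, joinMatchingDeg t n i : ℕ) : ℤ) + 2 ≤ ((∑ i, d i : ℕ) : ℤ) := by
      exact_mod_cast hle
    split_ifs at hsum <;> linarith
  · rintro l ⟨hl, hlP⟩
    by_contra! hlt
    refine not_potentiallyGraphic_joinMatchingDeg (by omega) hkr hC4
      (hlP _ ⟨antitone_joinMatchingDeg (by omega), _, hreal⟩ ?_)
    obtain ⟨x, hx⟩ := hl
    obtain ⟨y, hy⟩ := heven
    omega
  · rw [Nat.cast_add, hsum]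
    have hpar : Odd (n - (t + 3)) ↔ ¬ (n - t) % 2 = 1 := by
      rw [Nat.odd_iff]
      omega
    by_cases h : (n - t) % 2 = 1
    · rw [if_pos h, if_neg (by tauto)]
      push_cast
      ring
    · rw [if_neg h, if_pos (by tauto)]
      push_cast
      ring
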